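/- Let K be a compact interval and φ ∈ C²(K) with φ'' continuous and |φ''(x)| ≥ c > 0 for all x ∈ K. Then for every ε > 0 there is a constant C(ε, K, φ) such that for every δ ∈ (0,1/4) and every real U ≥ 1, the number of pairs of integers (u,t) with U ≤ u < 2U, t/u ∈ K, and ‖u φ(t/u)‖ < δ is at most C(ε,K,φ)(δ^{1−ε}U² + U log(2U)). -/

import Mathlib

open Set Real

/-- Distance from a real number to the nearest integer. -/
noncomputable def nint (y : ℝ) : ℝ := |y - round y|

/-- A point `(x, y)` together with the slope `p` of a line through it. -/
@[ext] structure Contact where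
  x : ℝ
  y : ℝ
  p : ℝ

namespace Contact

/-- The projectively dual contact element. -/
def dual (e : Contact) : Contact := ⟨e.p, e.x * e.p - e.y, e.x⟩

/-- The height of the point of `e'` above the line of `e`. -/
def gap (e e' : Contact) : ℝ := e'.y - e.y - e.p * (e'.x - e.x)

/-- The horizontal offset of an integer vector from the ray of a contact element. -/
def hoff (e : Contact) (v : ℤ × ℤ × ℤ) : ℝ := v.2.1 - v.1 * e.x

/-- The vertical offset of an integer vector from the tangent plane of a contact element. -/
def voff (e : Contact) (v : ℤ × ℤ × ℤ) : ℝ := v.2.2 - v.1 * e.y - e.p * (v.2.1 - v.1 * e.x)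

lemma dual_dual (e : Contact) : e.dual.dual = e := by
  ext <;> simp [dual, mul_comm]

lemma gap_dual (e e' : Contact) : gap e.dual e'.dual = gap e' e := by
  simp only [gap, dual]; ring

lemma voff_change (e e' : Contact) (v : ℤ × ℤ × ℤ) :
    e.voff v = e'.voff v + v.1 * gap e e' + (e'.p - e.p) * e'.hoff v := by
  simp only [gap, voff, hoff]; ring

end Contact

open Contact

/-- A family of contact elements that looks like the tangents of a uniformly convex arc. The
conditions are invariant under projective duality. -/
structure IsConvexArc (C R : ℝ) (E : Set Contact) : Prop where
  x_le : ∀ e ∈ E, |e.x| ≤ R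
  p_le : ∀ e ∈ E, |e.p| ≤ R
  le_gap : ∀ e ∈ E, ∀ e' ∈ E, (e'.x - e.x) ^ 2 ≤ C * gap e e'
  gap_le : ∀ e ∈ E, ∀ e' ∈ E, gap e e' ≤ C * (e'.x - e.x) ^ 2
  le_gap_p : ∀ e ∈ E, ∀ e' ∈ E, (e'.p - e.p) ^ 2 ≤ C * gap e e'
  gap_le_p : ∀ e ∈ E, ∀ e' ∈ E, gap e e' ≤ C * (e'.p - e.p) ^ 2

/-- The dual family. -/
def dualArc (E : Set Contact) : Set Contact := {e | e.dual ∈ E}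

lemma dual_mem_dualArc {E : Set Contact} {e : Contact} (he : e ∈ E) : e.dual ∈ dualArc E := by
  simpa [dualArc, dual_dual] using he

namespace IsConvexArc

variable {C R : ℝ} {E : Set Contact}

lemma dual (h : IsConvexArc C R E) : IsConvexArc C R (dualArc E) where
  x_le e he := h.p_le _ he
  p_le e he := h.x_le _ he
  le_gap e he e' he' := by
    have := h.le_gap_p _ he' _ he
    rw [gap_dual] at this
    simp only [Contact.dual] at this
    nlinarith
  gap_le e he e' he' := by
    have := h.gap_le_p _ he' _ he
    rw [gap_dual] at this
    simp only [Contact.dual] at this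
    nlinarith
  le_gap_p e he e' he' := by
    have := h.le_gap _ he' _ he
    rw [gap_dual] at this
    simp only [Contact.dual] at this
    nlinarith
  gap_le_p e he e' he' := by
    have := h.gap_le _ he' _ he
    rw [gap_dual] at this
    simp only [Contact.dual] at this
    nlinarith

lemma abs_p_sub_le (h : IsConvexArc C R E) (hC : 1 ≤ C) {e e' : Contact} (he : e ∈ E)
    (he' : e' ∈ E) : |e'.p - e.p| ≤ C * |e'.x - e.x| := by
  have h1 := h.le_gap_p e he e' he'
  have h2 := h.gap_le e he e' he'
  refine abs_le_of_sq_le_sq ?_ (by positivity)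
  rw [mul_pow, sq_abs]
  nlinarith

lemma abs_x_sub_le (h : IsConvexArc C R E) (hC : 1 ≤ C) {e e' : Contact} (he : e ∈ E)
    (he' : e' ∈ E) : |e'.x - e.x| ≤ C * |e'.p - e.p| := by
  have := h.dual.abs_p_sub_le hC (dual_mem_dualArc he) (dual_mem_dualArc he')
  simpa [Contact.dual] using this

lemma gap_nonneg (h : IsConvexArc C R E) (hC : 1 ≤ C) {e e' : Contact} (he : e ∈ E)
    (he' : e' ∈ E) : 0 ≤ gap e e' := by
  have h1 := h.le_gap e he e' he'
  by_contra! h2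
  nlinarith [sq_nonneg (e'.x - e.x)]

end IsConvexArc

/-- The integer vector `v` has height in `[U, 2U)` and lies near the cone over `E`. -/
def Near (E : Set Contact) (U κ : ℝ) (v : ℤ × ℤ × ℤ) : Prop :=
  U ≤ v.1 ∧ (v.1 : ℝ) < 2 * U ∧ ∃ e ∈ E, |e.hoff v| ≤ κ ∧ |e.voff v| ≤ κ ^ 2 / U

/-- The slope coordinate of an integer vector. -/
noncomputable def xpos (v : ℤ × ℤ × ℤ) : ℝ := v.2.1 / v.1

lemma hoff_eq (e : Contact) {v : ℤ × ℤ × ℤ} (hv : (0 : ℝ) < v.1) :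
    e.hoff v = v.1 * (xpos v - e.x) := by
  simp only [hoff, xpos]; field_simp

lemma abs_xpos_sub_le {e : Contact} {v : ℤ × ℤ × ℤ} {U A : ℝ} (hU : 0 < U) (hv : U ≤ v.1)
    (h : |e.hoff v| ≤ A) : |xpos v - e.x| ≤ A / U := by
  rw [hoff_eq e (hU.trans_le hv), abs_mul, abs_of_pos (hU.trans_le hv)] at h
  rw [le_div_iff₀ hU]
  nlinarith [abs_nonneg (xpos v - e.x)]

lemma IsConvexArc.near_bounds {C R : ℝ} {E : Set Contact} (h : IsConvexArc C R E) (hC : 1 ≤ C)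
    {U κ : ℝ} (hU : 0 < U) (hκ : 0 < κ) {v w : ℤ × ℤ × ℤ} (hv : Near E U κ v)
    (hw : U ≤ w.1) (hvw : |xpos v - xpos w| ≤ κ / U) {e : Contact} (he : e ∈ E)
    (hew : |e.hoff w| ≤ κ) : |e.hoff v| ≤ 4 * κ ∧ |e.voff v| ≤ 22 * C * κ ^ 2 / U := by
  obtain ⟨hv1, hv2, e', he', hv3, hv4⟩ := hv
  have hw' := abs_xpos_sub_le hU hw hew
  have hv' := abs_xpos_sub_le hU hv1 hv3
  have hv0 : (0 : ℝ) < v.1 := hU.trans_le hv1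
  obtain ⟨s, hs⟩ : ∃ s, s = κ / U := ⟨_, rfl⟩
  have hκs : κ = s * U := by rw [hs]; field_simp
  have hs0 : 0 < s := by rw [hs]; positivity
  rw [← hs] at hw' hv' hvw
  have hx : |xpos v - e.x| ≤ 2 * s := by
    have := abs_sub_le (xpos v) (xpos w) e.x
    linarith
  have hd : |e'.x - e.x| ≤ 3 * s := by
    have := abs_sub_le e'.x (xpos v) e.x
    rw [abs_sub_comm e'.x (xpos v)] at this
    linarith
  have hp := h.abs_p_sub_le hC he he'
  have hg := h.gap_le e he e' he'
  have hg0 := h.gap_nonneg hC he he'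
  constructor
  · rw [hoff_eq e hv0, abs_mul, abs_of_pos hv0, hκs]
    nlinarith [abs_nonneg (xpos v - e.x)]
  · rw [voff_change e e']
    have h1 : |(v.1 : ℝ) * gap e e'| ≤ 2 * U * (C * (3 * s) ^ 2) := by
      rw [abs_of_nonneg (by positivity)]
      have : (e'.x - e.x) ^ 2 ≤ (3 * s) ^ 2 := by
        rw [← sq_abs]; gcongr
      have : gap e e' ≤ C * (3 * s) ^ 2 := hg.trans (by gcongr)
      gcongr
    have h2 : |(e'.p - e.p) * e'.hoff v| ≤ C * (3 * s) * (s * U) := by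
      rw [abs_mul]
      have : |e'.p - e.p| ≤ C * (3 * s) := hp.trans (by gcongr)
      rw [← hκs]
      gcongr
    have h3 : |e'.voff v| ≤ C * (s ^ 2 * U) := by
      refine hv4.trans ?_
      rw [hκs]
      have : (s * U) ^ 2 / U = s ^ 2 * U := by field_simp
      rw [this]
      nlinarith [show 0 < s ^ 2 * U by positivity]
    have h4 : 22 * C * κ ^ 2 / U = 22 * C * (s ^ 2 * U) := by
      rw [hκs]; field_simp
    rw [h4]
    refine (abs_add_three _ _ _).trans ?_
    linarith

/-- The greatest common divisor of the coordinates. -/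
def vgcd (v : ℤ × ℤ × ℤ) : ℕ := Int.gcd v.1 (Int.gcd v.2.1 v.2.2)

/-- The cross product, up to the order and signs of the coordinates. -/
def cross (v w : ℤ × ℤ × ℤ) : ℤ × ℤ × ℤ :=
  (v.1 * w.2.1 - w.1 * v.2.1, v.1 * w.2.2 - w.1 * v.2.2, v.2.1 * w.2.2 - w.2.1 * v.2.2)

/-- The incidence pairing between vectors and dual vectors. -/
def pair (n z : ℤ × ℤ × ℤ) : ℤ := z.1 * n.2.2 - z.2.1 * n.2.1 + z.2.2 * n.1

lemma hoff_cross (e : Contact) (v w : ℤ × ℤ × ℤ) :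
    e.dual.hoff (cross v w) = v.1 * e.voff w - w.1 * e.voff v := by
  simp only [hoff, voff, Contact.dual, cross]; push_cast; ring

lemma voff_cross (e : Contact) (v w : ℤ × ℤ × ℤ) :
    e.dual.voff (cross v w) = e.hoff v * e.voff w - e.hoff w * e.voff v := by
  simp only [hoff, voff, Contact.dual, cross]; push_cast; ring

lemma cross_fst (e : Contact) (v w : ℤ × ℤ × ℤ) :
    ((cross v w).1 : ℝ) = v.1 * e.hoff w - w.1 * e.hoff v := by
  simp only [hoff, cross]; push_cast; ring

lemma pair_eq (e : Contact) (n z : ℤ × ℤ × ℤ) :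
    (pair n z : ℝ) = z.1 * e.dual.voff n - e.hoff z * e.dual.hoff n + e.voff z * n.1 := by
  simp only [hoff, voff, Contact.dual, pair]; push_cast; ring

lemma vgcd_mul (c : ℤ) (v : ℤ × ℤ × ℤ) :
    vgcd (c * v.1, c * v.2.1, c * v.2.2) = c.natAbs * vgcd v := by
  simp only [vgcd, Int.gcd_mul_left]
  simp only [Int.gcd, Int.natAbs_mul, Int.natAbs_natCast, Nat.gcd_mul_left]

lemma exists_eq_mul_vgcd {v : ℤ × ℤ × ℤ} (hv : v.1 ≠ 0) :
    ∃ w : ℤ × ℤ × ℤ, vgcd w = 1 ∧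
      v = ((vgcd v : ℤ) * w.1, (vgcd v : ℤ) * w.2.1, (vgcd v : ℤ) * w.2.2) := by
  have h1 : (vgcd v : ℤ) ∣ v.1 := Int.gcd_dvd_left _ _
  have h0 : (vgcd v : ℤ) ∣ (Int.gcd v.2.1 v.2.2 : ℤ) := Int.gcd_dvd_right _ _
  have h2 : (vgcd v : ℤ) ∣ v.2.1 := h0.trans (Int.gcd_dvd_left _ _)
  have h3 : (vgcd v : ℤ) ∣ v.2.2 := h0.trans (Int.gcd_dvd_right _ _)
  obtain ⟨a, ha⟩ := h1
  obtain ⟨b, hb⟩ := h2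
  obtain ⟨c, hc⟩ := h3
  have hv' : v = ((vgcd v : ℤ) * a, (vgcd v : ℤ) * b, (vgcd v : ℤ) * c) := by
    ext <;> assumption
  refine ⟨(a, b, c), ?_, hv'⟩
  have h := vgcd_mul (vgcd v) (a, b, c)
  simp only at h
  rw [← hv', Int.natAbs_natCast] at h
  have hpos : 0 < vgcd v := Int.gcd_pos_of_ne_zero_left _ hv
  nlinarith

lemma eq_of_proportional {v w : ℤ × ℤ × ℤ} (hv : 0 < v.1) (hw : 0 < w.1) (gv : vgcd v = 1)
    (gw : vgcd w = 1) (h2 : v.1 * w.2.1 = w.1 * v.2.1) (h3 : v.1 * w.2.2 = w.1 * v.2.2) :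
    v = w := by
  have e1 := vgcd_mul v.1 w
  have e2 := vgcd_mul w.1 v
  rw [h2, h3, mul_comm v.1 w.1, e2, gv, gw] at e1
  have h1 : v.1 = w.1 := by omega
  rw [h1] at h2 h3
  ext
  · exact h1
  · exact (mul_left_cancel₀ hw.ne' h2).symm
  · exact (mul_left_cancel₀ hw.ne' h3).symm

lemma dvd_cross_fst {n v w : ℤ × ℤ × ℤ} (gn : vgcd n = 1) (hv : pair n v = 0)
    (hw : pair n w = 0) : n.1 ∣ (cross v w).1 := by
  simp only [pair] at hv hw
  have a1 : n.1 ∣ (cross v w).1 * n.1 := Dvd.intro_left _ rfl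
  have a2 : n.1 ∣ (cross v w).1 * n.2.1 :=
    ⟨v.1 * w.2.2 - w.1 * v.2.2, by simp only [cross]; linear_combination w.1 * hv - v.1 * hw⟩
  have a3 : n.1 ∣ (cross v w).1 * n.2.2 :=
    ⟨v.2.1 * w.2.2 - w.2.1 * v.2.2, by
      simp only [cross]; linear_combination w.2.1 * hv - v.2.1 * hw⟩
  have b : n.1 ∣ (cross v w).1 * (Int.gcd n.2.1 n.2.2 : ℤ) := by
    rw [Int.gcd_eq_gcd_ab, mul_add, ← mul_assoc, ← mul_assoc]
    exact dvd_add (Dvd.dvd.mul_right a2 _) (Dvd.dvd.mul_right a3 _)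
  have b' : n.1 ∣ (cross v w).1 * (vgcd n : ℤ) := by
    rw [vgcd, Int.gcd_eq_gcd_ab, mul_add, ← mul_assoc, ← mul_assoc]
    exact dvd_add (Dvd.dvd.mul_right a1 _) (Dvd.dvd.mul_right b _)
  simpa [gn] using b'

lemma exists_eq_mul_primitive {v : ℤ × ℤ × ℤ} (hv : v.1 ≠ 0) :
    ∃ (c : ℤ) (w : ℤ × ℤ × ℤ), c ≠ 0 ∧ vgcd w = 1 ∧ 0 < w.1 ∧
      v = (c * w.1, c * w.2.1, c * w.2.2) := by
  obtain ⟨w, gw, hvw⟩ := exists_eq_mul_vgcd hv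
  have hg : (vgcd v : ℤ) ≠ 0 := by
    have : 0 < vgcd v := Int.gcd_pos_of_ne_zero_left _ hv
    omega
  have hw : w.1 ≠ 0 := by
    intro h0
    apply hv
    rw [hvw]
    simp [h0]
  rcases lt_or_gt_of_ne hw with h | h
  · refine ⟨-(vgcd v : ℤ), (-1 * w.1, -1 * w.2.1, -1 * w.2.2), by omega, ?_, by simpa using h, ?_⟩
    · rw [vgcd_mul, gw]; rfl
    · conv_lhs => rw [hvw]
      ext <;> simp
  · exact ⟨vgcd v, w, hg, gw, h, hvw⟩

lemma hoff_mul (e : Contact) (c : ℤ) (w : ℤ × ℤ × ℤ) :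
    e.hoff (c * w.1, c * w.2.1, c * w.2.2) = c * e.hoff w := by
  simp only [hoff]; push_cast; ring

lemma voff_mul (e : Contact) (c : ℤ) (w : ℤ × ℤ × ℤ) :
    e.voff (c * w.1, c * w.2.1, c * w.2.2) = c * e.voff w := by
  simp only [voff]; push_cast; ring

lemma abs_le_of_abs_int_mul_le {c : ℤ} (hc : c ≠ 0) {x B : ℝ} (h : |c * x| ≤ B) : |x| ≤ B := by
  have : (1 : ℝ) ≤ |(c : ℝ)| := by exact_mod_cast Int.one_le_abs hc
  rw [abs_mul] at h
  nlinarith [abs_nonneg x]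

lemma IsConvexArc.exists_normal {C R : ℝ} {E : Set Contact} (h : IsConvexArc C R E) (hC : 1 ≤ C)
    {U κ : ℝ} (hU : 0 < U) (hκ : 0 < κ) (hκC : 1100 * C * κ ≤ 1) {T : Finset (ℤ × ℤ × ℤ)}
    (hT : ∀ v ∈ T, Near E U κ v) (hg : ∀ v ∈ T, vgcd v = 1)
    (harc : ∀ v ∈ T, ∀ w ∈ T, |xpos v - xpos w| ≤ κ / U) (hT2 : 1 < T.card) :
    ∃ n : ℤ × ℤ × ℤ, vgcd n = 1 ∧ 0 < n.1 ∧ (∀ z ∈ T, pair n z = 0) ∧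
      ∃ e ∈ E, |e.dual.hoff n| ≤ 88 * C * κ ^ 2 ∧ |e.dual.voff n| ≤ 176 * C * κ ^ 3 / U := by
  obtain ⟨v, hv, w, hw, hvw⟩ := Finset.one_lt_card.1 hT2
  obtain ⟨hv1, hv2, e, he, hev, -⟩ := hT v hv
  have key : ∀ z ∈ T, |e.hoff z| ≤ 4 * κ ∧ |e.voff z| ≤ 22 * C * κ ^ 2 / U := fun z hz =>
    h.near_bounds hC hU hκ (hT z hz) hv1 (harc z hz v hv) he hev
  have pos : ∀ z ∈ T, (0 : ℝ) < z.1 := fun z hz => hU.trans_le (hT z hz).1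
  have lt : ∀ z ∈ T, (z.1 : ℝ) ≤ 2 * U := fun z hz => (hT z hz).2.1.le
  set B := 22 * C * κ ^ 2 / U with hB
  have hB0 : 0 < B := by positivity
  have hBU : U * B = 22 * C * κ ^ 2 := by rw [hB]; field_simp
  have hκ1 : κ ≤ 1 / 1100 := by nlinarith
  have hCκ2 : C * κ ^ 2 ≤ 1 / 1100 * κ := by nlinarith
  have hCκ3 : C * κ ^ 3 ≤ 1 / 1100 * (1 / 1100 * κ) := by nlinarith
  have m_mul : ∀ {a b a' b' : ℝ}, |a| ≤ a' → |b| ≤ b' → |a * b| ≤ a' * b' := fun ha hb => by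
    rw [abs_mul]
    exact mul_le_mul ha hb (abs_nonneg _) ((abs_nonneg _).trans ha)
  have aU : ∀ z ∈ T, |(z.1 : ℝ)| ≤ 2 * U := fun z hz => by
    rw [abs_of_pos (pos z hz)]; exact lt z hz
  have hm1 : |((cross v w).1 : ℝ)| ≤ 16 * U * κ := by
    rw [cross_fst e]
    refine (abs_sub _ _).trans ?_
    have := m_mul (aU v hv) (key w hw).1
    have := m_mul (aU w hw) (key v hv).1
    linarith
  have hm2 : |e.dual.hoff (cross v w)| ≤ 88 * C * κ ^ 2 := by
    rw [hoff_cross]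
    refine (abs_sub _ _).trans ?_
    have := m_mul (aU v hv) (key w hw).2
    have := m_mul (aU w hw) (key v hv).2
    linarith
  have hm3 : |e.dual.voff (cross v w)| ≤ 8 * κ * B := by
    rw [voff_cross]
    refine (abs_sub _ _).trans ?_
    have := m_mul (key v hv).1 (key w hw).2
    have := m_mul (key w hw).1 (key v hv).2
    linarith
  have hm0 : (cross v w).1 ≠ 0 := by
    intro h0
    have h4 : e.dual.hoff (cross v w) = ((cross v w).2.1 : ℝ) := by
      simp [hoff, h0]
    rw [h4] at hm2
    have h5 : (cross v w).2.1 = 0 := by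
      rw [← Int.abs_lt_one_iff]
      have : |((cross v w).2.1 : ℝ)| < 1 := by linarith
      exact_mod_cast this
    simp only [cross] at h0 h5
    exact hvw (eq_of_proportional (by exact_mod_cast pos v hv) (by exact_mod_cast pos w hw)
      (hg v hv) (hg w hw) (by omega) (by omega))
  obtain ⟨c, n, hc, gn, hn, hmn⟩ := exists_eq_mul_primitive hm0
  refine ⟨n, gn, hn, fun z hz => ?_, e, he, ?_, ?_⟩
  · have h1 : pair (cross v w) z = 0 := by
      rw [← Int.abs_lt_one_iff]
      have : |(pair (cross v w) z : ℝ)| < 1 := by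
        rw [pair_eq e]
        have b1 := m_mul (aU z hz) hm3
        have b2 := m_mul (key z hz).1 hm2
        have b3 := m_mul (key z hz).2 hm1
        have b4 := abs_add_le ((z.1 : ℝ) * e.dual.voff (cross v w) -
          e.hoff z * e.dual.hoff (cross v w)) (e.voff z * ((cross v w).1 : ℝ))
        have b5 := abs_sub ((z.1 : ℝ) * e.dual.voff (cross v w))
          (e.hoff z * e.dual.hoff (cross v w))
        have e1 : 2 * U * (8 * κ * B) = 352 * (C * κ ^ 3) := by
          linear_combination 16 * κ * hBU
        have e2 : B * (16 * U * κ) = 352 * (C * κ ^ 3) := by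
          linear_combination 16 * κ * hBU
        have e3 : 4 * κ * (88 * C * κ ^ 2) = 352 * (C * κ ^ 3) := by ring
        linarith
      exact_mod_cast this
    have h2 : pair (cross v w) z = c * pair n z := by
      rw [hmn]; simp only [pair]; ring
    rw [h2] at h1
    exact (mul_eq_zero.1 h1).resolve_left hc
  · rw [hmn, hoff_mul] at hm2
    exact abs_le_of_abs_int_mul_le hc hm2
  · rw [hmn, voff_mul] at hm3
    refine (abs_le_of_abs_int_mul_le hc hm3).trans_eq ?_
    rw [hB]; ring

lemma IsConvexArc.lt_voff {C R : ℝ} {E : Set Contact} (h : IsConvexArc C R E) (hC : 1 ≤ C)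
    {U s : ℝ} (hU : 0 < U) (hs : 0 < s) {v : ℤ × ℤ × ℤ} (hv : Near E U (s * U) v)
    {e : Contact} (he : e ∈ E) (hfar : (4 * C ^ 2 + 1) * s < |xpos v - e.x|) :
    s ^ 2 < e.voff v / v.1 := by
  obtain ⟨hv1, hv2, e', he', hv3, hv4⟩ := hv
  have hv0 : (0 : ℝ) < v.1 := hU.trans_le hv1
  have hv' := abs_xpos_sub_le hU hv1 hv3
  rw [mul_div_cancel_right₀ _ hU.ne'] at hv'
  have hv4' : |e'.voff v| ≤ s ^ 2 * U := hv4.trans_eq (by field_simp)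
  obtain ⟨d, hd⟩ : ∃ d, d = |e'.x - e.x| := ⟨_, rfl⟩
  have hd4 : 4 * C ^ 2 * s < d := by
    have := abs_sub_le (xpos v) e'.x e.x
    rw [← hd] at this
    linarith
  have hp := h.abs_p_sub_le hC he he'
  rw [← hd] at hp
  have hg := h.le_gap e he e' he'
  rw [← sq_abs, ← hd] at hg
  have hd0 : 0 < d := lt_trans (by positivity) hd4
  have hg' : 4 * C * s * d ≤ gap e e' := by
    have : C * (4 * C * s * d) ≤ C * gap e e' := by nlinarith
    exact le_of_mul_le_mul_left this (by linarith)
  have h1 : U * (4 * C * s * d) ≤ v.1 * gap e e' := by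
    apply mul_le_mul hv1 hg' (by positivity) hv0.le
  have h2 : |(e'.p - e.p) * e'.hoff v| ≤ C * d * (s * U) := by
    rw [abs_mul]; gcongr
  have h3 : 2 * s ^ 2 * U < e.voff v := by
    rw [voff_change e e']
    have a1 := neg_le_of_abs_le h2
    have a2 := neg_le_of_abs_le hv4'
    have a3 : s * 4 ≤ C * d := by
      have : 1 * s ≤ C ^ 2 * s := by gcongr; nlinarith
      nlinarith
    have a4 : s * U * (s * 4) ≤ s * U * (C * d) := by gcongr
    have a5 : 0 < s ^ 2 * U := by positivity
    nlinarith
  rw [lt_div_iff₀ hv0]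
  have : s ^ 2 * v.1 ≤ s ^ 2 * (2 * U) := by gcongr
  linarith

lemma IsConvexArc.not_three_far {C R : ℝ} {E : Set Contact} (h : IsConvexArc C R E) (hC : 1 ≤ C)
    {U s : ℝ} (hU : 0 < U) (hs : 0 < s) {n v₁ v₂ v₃ : ℤ × ℤ × ℤ} (hn : 0 < n.1)
    (h₁ : Near E U (s * U) v₁) (h₂ : Near E U (s * U) v₂) (h₃ : Near E U (s * U) v₃)
    (p₁ : pair n v₁ = 0) (p₂ : pair n v₂ = 0) (p₃ : pair n v₃ = 0)
    (h₁₂ : xpos v₁ + (4 * C ^ 2 + 2) * s < xpos v₂)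
    (h₂₃ : xpos v₂ + (4 * C ^ 2 + 2) * s < xpos v₃) : False := by
  obtain ⟨hv1, hv2, e, he, hv3, hv4⟩ := id h₂
  have hv' := abs_xpos_sub_le hU hv1 hv3
  rw [mul_div_cancel_right₀ _ hU.ne'] at hv'
  have hv4' : |e.voff v₂| ≤ s ^ 2 * U := hv4.trans_eq (by field_simp)
  have hv0 : (0 : ℝ) < v₂.1 := hU.trans_le hv1
  have hn' : (0 : ℝ) < n.1 := by exact_mod_cast hn
  have form : ∀ v : ℤ × ℤ × ℤ, (0 : ℝ) < v.1 → pair n v = 0 →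
      n.1 * (e.voff v / v.1) = e.dual.hoff n * (xpos v - e.x) - e.dual.voff n := by
    intro v hv hp
    have hp' : (pair n v : ℝ) = 0 := by exact_mod_cast hp
    rw [pair_eq e, hoff_eq e hv] at hp'
    field_simp
    linear_combination hp'
  have f₁ := form v₁ (hU.trans_le h₁.1) p₁
  have f₂ := form v₂ hv0 p₂
  have f₃ := form v₃ (hU.trans_le h₃.1) p₃
  have b₁ : s ^ 2 < e.voff v₁ / v₁.1 := by
    apply h.lt_voff hC hU hs h₁ he
    rw [lt_abs]; right
    have := (abs_le.1 hv').2
    linarith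
  have b₃ : s ^ 2 < e.voff v₃ / v₃.1 := by
    apply h.lt_voff hC hU hs h₃ he
    rw [lt_abs]; left
    have := (abs_le.1 hv').1
    linarith
  have b₂ : e.voff v₂ / v₂.1 ≤ s ^ 2 := by
    rw [div_le_iff₀ hv0]
    have := (abs_le.1 hv4').2
    have : s ^ 2 * U ≤ s ^ 2 * v₂.1 := by gcongr
    linarith
  have hp : 0 < (4 * C ^ 2 + 2) * s := by positivity
  generalize e.voff v₁ / v₁.1 = B₁ at *
  generalize e.voff v₂ / v₂.1 = B₂ at *
  generalize e.voff v₃ / v₃.1 = B₃ at *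
  have c₁ : 0 < (xpos v₃ - xpos v₂) * (B₁ - s ^ 2) := mul_pos (by linarith) (by linarith)
  have c₃ : 0 < (xpos v₂ - xpos v₁) * (B₃ - s ^ 2) := mul_pos (by linarith) (by linarith)
  have c₂ : 0 ≤ (xpos v₃ - xpos v₁) * (s ^ 2 - B₂) := mul_nonneg (by linarith) (by linarith)
  have : n.1 * ((xpos v₃ - xpos v₂) * (B₁ - s ^ 2) + (xpos v₂ - xpos v₁) * (B₃ - s ^ 2) +
      (xpos v₃ - xpos v₁) * (s ^ 2 - B₂)) = 0 := by
    linear_combination (xpos v₃ - xpos v₂) * f₁ + (xpos v₂ - xpos v₁) * f₃ -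
      (xpos v₃ - xpos v₁) * f₂
  have : 0 < n.1 * ((xpos v₃ - xpos v₂) * (B₁ - s ^ 2) + (xpos v₂ - xpos v₁) * (B₃ - s ^ 2) +
      (xpos v₃ - xpos v₁) * (s ^ 2 - B₂)) := mul_pos hn' (by linarith)
  linarith

lemma card_le_of_separated {ι : Type*} (T : Finset ι) (f : ι → ℝ) {a G σ : ℝ} (hσ : 0 < σ)
    (hf : ∀ v ∈ T, a ≤ f v ∧ f v ≤ a + G)
    (hsep : ∀ v ∈ T, ∀ w ∈ T, v ≠ w → σ ≤ |f v - f w|) (hG : 0 ≤ G) :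
    (T.card : ℝ) ≤ G / σ + 1 := by
  have h1 : T.card ≤ (Finset.range (⌊G / σ⌋₊ + 1)).card := by
    refine Finset.card_le_card_of_injOn (fun v => ⌊(f v - a) / σ⌋₊) (fun v hv => ?_) ?_
    · simp only [Finset.coe_range, Set.mem_Iio]
      refine Nat.lt_succ_of_le (Nat.floor_le_floor ?_)
      have := (hf v hv).2
      gcongr
      linarith
    · intro v hv w hw hvw
      by_contra hne
      have hs := hsep v hv w hw hne
      have p1 : 0 ≤ (f v - a) / σ := div_nonneg (by linarith [(hf v hv).1]) hσ.le
      have p2 : 0 ≤ (f w - a) / σ := div_nonneg (by linarith [(hf w hw).1]) hσ.le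
      have q1 := Nat.floor_le p1
      have q2 := Nat.floor_le p2
      have q3 := Nat.lt_floor_add_one ((f v - a) / σ)
      have q4 := Nat.lt_floor_add_one ((f w - a) / σ)
      simp only at hvw
      rw [hvw] at q1 q3
      have : |(f v - a) / σ - (f w - a) / σ| < 1 := by
        rw [abs_lt]; constructor <;> linarith
      rw [← sub_div, abs_div, abs_of_pos hσ, div_lt_one hσ] at this
      have e : f v - a - (f w - a) = f v - f w := by ring
      rw [e] at this
      linarith
  rw [Finset.card_range] at h1
  calc (T.card : ℝ) ≤ ((⌊G / σ⌋₊ + 1 : ℕ) : ℝ) := by exact_mod_cast h1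
    _ ≤ _ := by push_cast; gcongr; exact Nat.floor_le (by positivity)

lemma card_image_floor_le {ι : Type*} (T : Finset ι) (f : ι → ℝ) {a B : ℝ}
    (hf : ∀ v ∈ T, |f v - a| ≤ B) (hB : 0 ≤ B) :
    ((T.image fun v => ⌊f v⌋).card : ℝ) ≤ 2 * B + 2 := by
  have h1 : T.image (fun v => ⌊f v⌋) ⊆ Finset.Icc ⌊a - B⌋ ⌊a + B⌋ := by
    intro i hi
    obtain ⟨v, hv, rfl⟩ := Finset.mem_image.1 hi
    have := abs_le.1 (hf v hv)
    exact Finset.mem_Icc.2 ⟨Int.floor_le_floor (by linarith), Int.floor_le_floor (by linarith)⟩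
  have h2 := Finset.card_le_card h1
  rw [Int.card_Icc] at h2
  have h3 : ⌊a - B⌋ ≤ ⌊a + B⌋ := Int.floor_le_floor (by linarith)
  have h4 : ((⌊a + B⌋ + 1 - ⌊a - B⌋).toNat : ℝ) = ⌊a + B⌋ + 1 - ⌊a - B⌋ := by
    have : ((⌊a + B⌋ + 1 - ⌊a - B⌋).toNat : ℤ) = ⌊a + B⌋ + 1 - ⌊a - B⌋ :=
      Int.toNat_of_nonneg (by omega)
    exact_mod_cast this
  have h5 := Int.floor_le (a + B)
  have h6 := Int.lt_floor_add_one (a - B)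
  have h7 : ((T.image fun v => ⌊f v⌋).card : ℝ) ≤ ((⌊a + B⌋ + 1 - ⌊a - B⌋).toNat : ℝ) := by
    exact_mod_cast h2
  linarith

lemma div_le_abs_xpos_sub {U : ℝ} (hU : 0 < U) {n v w : ℤ × ℤ × ℤ} (gn : vgcd n = 1)
    (hn : 0 < n.1) (hv : U ≤ v.1) (hv' : v.1 < 2 * U) (hw : U ≤ w.1) (hw' : w.1 < 2 * U)
    (gv : vgcd v = 1) (gw : vgcd w = 1) (pv : pair n v = 0) (pw : pair n w = 0) (hvw : v ≠ w) :
    n.1 / (4 * U ^ 2) ≤ |xpos v - xpos w| := by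
  have hv0 : (0 : ℝ) < v.1 := hU.trans_le hv
  have hw0 : (0 : ℝ) < w.1 := hU.trans_le hw
  have hne : (cross v w).1 ≠ 0 := by
    intro h0
    simp only [cross] at h0
    simp only [pair] at pv pw
    have h1 : n.1 * (v.1 * w.2.2 - w.1 * v.2.2) = 0 := by
      linear_combination v.1 * pw - w.1 * pv + n.2.1 * h0
    have h2 := (mul_eq_zero.1 h1).resolve_left hn.ne'
    exact hvw (eq_of_proportional (by exact_mod_cast hv0) (by exact_mod_cast hw0) gv gw
      (by linarith) (by linarith))
  have h1 : n.1 ≤ |(cross v w).1| :=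
    Int.le_of_dvd (abs_pos.2 hne) ((dvd_abs _ _).2 (dvd_cross_fst gn pv pw))
  have h2 : (n.1 : ℝ) ≤ |((cross v w).1 : ℝ)| := by exact_mod_cast h1
  have h3 : xpos v - xpos w = -((cross v w).1 : ℝ) / (v.1 * w.1) := by
    simp only [xpos, cross]; push_cast; field_simp; ring
  rw [h3, abs_div, abs_neg, abs_of_pos (mul_pos hv0 hw0)]
  have hn' : (0 : ℝ) < n.1 := by exact_mod_cast hn
  have h4 : (v.1 : ℝ) * w.1 ≤ 4 * U ^ 2 := by nlinarith
  exact div_le_div₀ (abs_nonneg _) h2 (by positivity) h4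

lemma IsConvexArc.card_line_le {C R : ℝ} {E : Set Contact} (h : IsConvexArc C R E) (hC : 1 ≤ C)
    {U κ : ℝ} (hU : 0 < U) (hκ : 0 < κ) {n : ℤ × ℤ × ℤ} (gn : vgcd n = 1) (hn : 0 < n.1)
    {T : Finset (ℤ × ℤ × ℤ)} (hT : ∀ v ∈ T, Near E U κ v) (hg : ∀ v ∈ T, vgcd v = 1)
    (hp : ∀ v ∈ T, pair n v = 0) (h5 : 5 ≤ T.card) :
    (n.1 : ℝ) ≤ 4 * (4 * C ^ 2 + 2) * U * κ ∧
      (T.card : ℝ) ≤ 16 * (4 * C ^ 2 + 2) * U * κ / n.1 := by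
  have hne : T.Nonempty := Finset.card_pos.1 (by omega)
  obtain ⟨a, ha, hamin⟩ := T.exists_min_image xpos hne
  obtain ⟨b, hb, hbmax⟩ := T.exists_max_image xpos hne
  have hn' : (0 : ℝ) < n.1 := by exact_mod_cast hn
  obtain ⟨s, hs⟩ : ∃ s, s = κ / U := ⟨_, rfl⟩
  have hκs : κ = s * U := by rw [hs]; field_simp
  have hs0 : 0 < s := by rw [hs]; positivity
  obtain ⟨G, hG⟩ : ∃ G, G = (4 * C ^ 2 + 2) * s := ⟨_, rfl⟩
  have hG0 : 0 < G := by rw [hG]; positivity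
  have hsub : T ⊆ (T.filter fun v => xpos v ≤ xpos a + G) ∪
      (T.filter fun v => xpos b - G ≤ xpos v) := by
    intro v hv
    by_contra hcon
    simp only [Finset.mem_union, Finset.mem_filter, hv, true_and, not_or, not_le] at hcon
    rw [hκs] at hT
    refine h.not_three_far hC hU hs0 hn (hT a ha) (hT v hv) (hT b hb) (hp a ha) (hp v hv) (hp b hb)
      ?_ ?_
    · rw [← hG]; exact hcon.1
    · rw [← hG]; linarith [hcon.2]
  have hsep : ∀ v ∈ T, ∀ w ∈ T, v ≠ w → n.1 / (4 * U ^ 2) ≤ |xpos v - xpos w| :=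
    fun v hv w hw hvw => div_le_abs_xpos_sub hU gn hn (hT v hv).1 (hT v hv).2.1 (hT w hw).1
      (hT w hw).2.1 (hg v hv) (hg w hw) (hp v hv) (hp w hw) hvw
  have c1 := card_le_of_separated (T.filter fun v => xpos v ≤ xpos a + G) xpos (a := xpos a)
    (G := G) (σ := n.1 / (4 * U ^ 2)) (by positivity)
    (fun v hv => ⟨hamin v (Finset.mem_filter.1 hv).1, (Finset.mem_filter.1 hv).2⟩)
    (fun v hv w hw => hsep v (Finset.mem_filter.1 hv).1 w (Finset.mem_filter.1 hw).1) hG0.le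
  have c2 := card_le_of_separated (T.filter fun v => xpos b - G ≤ xpos v) xpos (a := xpos b - G)
    (G := G) (σ := n.1 / (4 * U ^ 2)) (by positivity)
    (fun v hv => ⟨(Finset.mem_filter.1 hv).2, by
      have := hbmax v (Finset.mem_filter.1 hv).1
      linarith⟩)
    (fun v hv w hw => hsep v (Finset.mem_filter.1 hv).1 w (Finset.mem_filter.1 hw).1) hG0.le
  have c3 : (T.card : ℝ) ≤ ((T.filter fun v => xpos v ≤ xpos a + G).card : ℝ) +
      ((T.filter fun v => xpos b - G ≤ xpos v).card : ℝ) := by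
    exact_mod_cast (Finset.card_le_card hsub).trans (Finset.card_union_le _ _)
  have e1 : G / (n.1 / (4 * U ^ 2)) = 4 * (4 * C ^ 2 + 2) * U * κ / n.1 := by
    rw [hG, hκs]; field_simp
  rw [e1] at c1 c2
  have h5' : (5 : ℝ) ≤ T.card := by exact_mod_cast h5
  have e2 : 16 * (4 * C ^ 2 + 2) * U * κ / n.1 = 4 * (4 * (4 * C ^ 2 + 2) * U * κ / n.1) := by
    ring
  rw [e2]
  have h6 : 1 ≤ 4 * (4 * C ^ 2 + 2) * U * κ / n.1 := by linarith
  exact ⟨(one_le_div hn').1 h6, by linarith⟩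

lemma IsConvexArc.card_image_arc_le {C R : ℝ} {E : Set Contact} (h : IsConvexArc C R E)
    (hR : 0 ≤ R) {U κ : ℝ} (hU : 0 < U) (hκ : 0 < κ) {S : Finset (ℤ × ℤ × ℤ)}
    (hS : ∀ v ∈ S, Near E U κ v) :
    ((S.image fun v => ⌊xpos v * U / κ⌋).card : ℝ) ≤ 2 * (R * U / κ) + 4 := by
  have := card_image_floor_le S (fun v => xpos v * U / κ) (a := 0) (B := R * U / κ + 1) ?_
    (by positivity)
  · linarith
  · intro v hv
    obtain ⟨hv1, hv2, e, he, hv3, hv4⟩ := hS v hv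
    have h1 := abs_xpos_sub_le hU hv1 hv3
    have h2 := h.x_le e he
    have h3 : |xpos v| ≤ R + κ / U := by
      have := abs_add_le (xpos v - e.x) e.x
      rw [sub_add_cancel] at this
      linarith
    rw [sub_zero, abs_div, abs_mul, abs_of_pos hU, abs_of_pos hκ]
    calc |xpos v| * U / κ ≤ (R + κ / U) * U / κ := by gcongr
      _ = _ := by field_simp

lemma abs_xpos_sub_le_of_floor_eq {U κ : ℝ} (hU : 0 < U) (hκ : 0 < κ) {v w : ℤ × ℤ × ℤ}
    (hvw : ⌊xpos v * U / κ⌋ = ⌊xpos w * U / κ⌋) : |xpos v - xpos w| ≤ κ / U := by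
  have h1 := Int.abs_sub_lt_one_of_floor_eq_floor hvw
  have h2 : xpos v * U / κ - xpos w * U / κ = (xpos v - xpos w) * (U / κ) := by ring
  rw [h2, abs_mul, abs_of_pos (by positivity : 0 < U / κ)] at h1
  have h3 : κ / U = 1 / (U / κ) := by field_simp
  rw [h3, le_div_iff₀ (by positivity)]
  exact h1.le

lemma Near.mono {E : Set Contact} {U κ κ' : ℝ} {v : ℤ × ℤ × ℤ} (h : Near E U κ' v) (hU : 0 < U)
    (hκ' : 0 ≤ κ') (hκκ : κ' ≤ κ) : Near E U κ v := by
  obtain ⟨h1, h2, e, he, h3, h4⟩ := h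
  exact ⟨h1, h2, e, he, h3.trans hκκ, h4.trans (by gcongr)⟩

lemma IsConvexArc.card_le_sum_lines {C R : ℝ} {E : Set Contact} (h : IsConvexArc C R E)
    (hC : 1 ≤ C) (hR : 0 ≤ R) {U κ κ' : ℝ} (hU : 0 < U) (hκ' : 0 < κ') (hκκ : κ' ≤ κ)
    (hκC : 1100 * C * κ ≤ 1)
    {S : Finset (ℤ × ℤ × ℤ)} (hS : ∀ v ∈ S, Near E U κ' v) (hg : ∀ v ∈ S, vgcd v = 1) :
    ∃ L : Finset (ℤ × ℤ × ℤ),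
      (∀ n ∈ L, vgcd n = 1 ∧ 0 < n.1 ∧ (n.1 : ℝ) ≤ 4 * (4 * C ^ 2 + 2) * U * κ' ∧
        ∃ e ∈ dualArc E, |e.hoff n| ≤ 88 * C * κ ^ 2 ∧ |e.voff n| ≤ 176 * C * κ ^ 3 / U) ∧
      (S.card : ℝ) ≤ 4 * (2 * (R * U / κ) + 4) +
        16 * (4 * C ^ 2 + 2) * U * κ' * ∑ n ∈ L, 1 / (n.1 : ℝ) := by
  classical
  have hκ := hκ'.trans_le hκκ
  have hS' : ∀ v ∈ S, Near E U κ v := fun v hv => (hS v hv).mono hU hκ'.le hκκ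
  set f : ℤ × ℤ × ℤ → ℤ := fun v => ⌊xpos v * U / κ⌋ with hf
  set T : ℤ × ℤ × ℤ → Finset (ℤ × ℤ × ℤ) := fun v => S.filter fun w => f w = f v with hTdef
  have key : ∀ v ∈ S.filter (fun v => 5 ≤ (T v).card), ∃ n : ℤ × ℤ × ℤ,
      vgcd n = 1 ∧ 0 < n.1 ∧ (∀ z ∈ T v, pair n z = 0) ∧
      ∃ e ∈ E, |e.dual.hoff n| ≤ 88 * C * κ ^ 2 ∧ |e.dual.voff n| ≤ 176 * C * κ ^ 3 / U := by
    intro v hv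
    refine h.exists_normal hC hU hκ hκC (fun z hz => hS' z (Finset.mem_filter.1 hz).1)
      (fun z hz => hg z (Finset.mem_filter.1 hz).1) (fun z hz w hw => ?_) ?_
    · exact abs_xpos_sub_le_of_floor_eq hU hκ
        ((Finset.mem_filter.1 hz).2.trans (Finset.mem_filter.1 hw).2.symm)
    · have := (Finset.mem_filter.1 hv).2
      omega
  choose! N gN posN pairN hN using key
  set Sb := S.filter (fun v => 5 ≤ (T v).card) with hSb
  have line : ∀ n ∈ Sb.image N, (n.1 : ℝ) ≤ 4 * (4 * C ^ 2 + 2) * U * κ' ∧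
      ((S.filter fun z => pair n z = 0).card : ℝ) ≤ 16 * (4 * C ^ 2 + 2) * U * κ' / n.1 := by
    intro n hn
    obtain ⟨v, hv, rfl⟩ := Finset.mem_image.1 hn
    refine h.card_line_le hC hU hκ' (gN v hv) (posN v hv)
      (fun z hz => hS z (Finset.mem_filter.1 hz).1)
      (fun z hz => hg z (Finset.mem_filter.1 hz).1) (fun z hz => (Finset.mem_filter.1 hz).2) ?_
    refine (Finset.mem_filter.1 hv).2.trans (Finset.card_le_card fun z hz => ?_)
    exact Finset.mem_filter.2 ⟨(Finset.mem_filter.1 hz).1, pairN v hv z hz⟩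
  refine ⟨Sb.image N, fun n hn => ?_, ?_⟩
  · have h3 := (line n hn).1
    obtain ⟨v, hv, rfl⟩ := Finset.mem_image.1 hn
    obtain ⟨e, he, h4, h5⟩ := hN v hv
    exact ⟨gN v hv, posN v hv, h3, e.dual, dual_mem_dualArc he, h4, h5⟩
  · have hsplit : S.card = Sb.card + (S.filter fun v => ¬ 5 ≤ (T v).card).card :=
      (Finset.card_filter_add_card_filter_not _).symm
    have ha : (S.filter fun v => ¬ 5 ≤ (T v).card).card ≤ 4 * (S.image f).card := by
      refine (Finset.card_le_mul_card_image (f := f) _ 4 fun i hi => ?_).trans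
        (Nat.mul_le_mul_left _ (Finset.card_le_card
          (Finset.image_subset_image (Finset.filter_subset _ _))))
      obtain ⟨v, hv, rfl⟩ := Finset.mem_image.1 hi
      have h1 := (Finset.mem_filter.1 hv).2
      refine le_trans (Finset.card_le_card (t := T v) fun z hz => ?_) (by omega : (T v).card ≤ 4)
      rw [Finset.mem_filter] at hz
      exact Finset.mem_filter.2 ⟨(Finset.mem_filter.1 hz.1).1, hz.2⟩
    have hb : (Sb.card : ℝ) ≤ 16 * (4 * C ^ 2 + 2) * U * κ' * ∑ n ∈ Sb.image N, 1 / (n.1 : ℝ) := by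
      have h1 : Sb ⊆ (Sb.image N).biUnion fun n => S.filter fun z => pair n z = 0 := by
        intro v hv
        have hvS := (Finset.mem_filter.1 hv).1
        exact Finset.mem_biUnion.2 ⟨N v, Finset.mem_image_of_mem _ hv, Finset.mem_filter.2
          ⟨hvS, pairN v hv v (Finset.mem_filter.2 ⟨hvS, rfl⟩)⟩⟩
      have h2 := (Finset.card_le_card h1).trans Finset.card_biUnion_le
      calc (Sb.card : ℝ) ≤ ∑ n ∈ Sb.image N, ((S.filter fun z => pair n z = 0).card : ℝ) := by
            exact_mod_cast h2
        _ ≤ ∑ n ∈ Sb.image N, 16 * (4 * C ^ 2 + 2) * U * κ' / n.1 :=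
            Finset.sum_le_sum fun n hn => (line n hn).2
        _ = _ := by rw [Finset.mul_sum]; simp only [mul_one_div]
    have hc := h.card_image_arc_le hR hU hκ hS'
    have ha' : ((S.filter fun v => ¬ 5 ≤ (T v).card).card : ℝ) ≤ 4 * ((S.image f).card : ℝ) := by
      exact_mod_cast ha
    rw [hsplit]
    push_cast
    linarith

lemma two_rpow_neg_lt_one {ε : ℝ} (hε : 0 < ε) : (2 : ℝ) ^ (-ε) < 1 :=
  Real.rpow_lt_one_of_one_lt_of_neg (by norm_num) (by linarith)

lemma sum_inv_le_of_dyadic {ι : Type*} {f : ι → ℝ} {K ε H₀ : ℝ} (hK : 0 ≤ K) (hε : 0 < ε)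
    {W : Finset ι} (hf : ∀ v ∈ W, 1 ≤ f v) (hfH : ∀ v ∈ W, f v ≤ H₀) (hH₀ : 0 < H₀)
    (hcount : ∀ D : ℝ, 0 < D → D ≤ H₀ → ∀ S ⊆ W, (∀ v ∈ S, D ≤ f v ∧ f v < 2 * D) →
      (S.card : ℝ) ≤ K * D ^ (1 + ε)) :
    ∑ v ∈ W, 1 / f v ≤ K * H₀ ^ ε * (1 / (1 - 2 ^ (-ε))) := by
  have h2 := two_rpow_neg_lt_one hε
  have main : ∀ n : ℕ, ∀ H : ℝ, 0 < H → H ≤ H₀ → H < 2 ^ n / 2 → ∀ S ⊆ W, (∀ v ∈ S, f v < 2 * H) →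
      ∑ v ∈ S, 1 / f v ≤ K * H ^ ε * (1 / (1 - 2 ^ (-ε))) := by
    intro n
    induction n with
    | zero =>
      intro H hH _ hHn S hS hSf
      have : S = ∅ := by
        refine Finset.eq_empty_of_forall_notMem fun v hv => ?_
        have := hf v (hS hv)
        have := hSf v hv
        norm_num at hHn
        linarith
      rw [this, Finset.sum_empty]
      have : 0 < 1 - (2 : ℝ) ^ (-ε) := by linarith
      positivity
    | succ n ih =>
      intro H hH hHH hHn S hS hSf
      rw [← Finset.sum_filter_add_sum_filter_not S (fun v => H ≤ f v)]
      have h3 := ih (H / 2) (by linarith) (by linarith) (by rw [pow_succ] at hHn; linarith)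
        (S.filter fun v => ¬ H ≤ f v) ((Finset.filter_subset _ _).trans hS)
        (fun v hv => by have := (Finset.mem_filter.1 hv).2; linarith)
      have h4 : ∑ v ∈ S.filter (fun v => H ≤ f v), 1 / f v ≤ K * H ^ ε := by
        have h5 := hcount H hH hHH (S.filter fun v => H ≤ f v) ((Finset.filter_subset _ _).trans hS)
          (fun v hv => ⟨(Finset.mem_filter.1 hv).2, hSf v (Finset.mem_filter.1 hv).1⟩)
        calc ∑ v ∈ S.filter (fun v => H ≤ f v), 1 / f v
            ≤ ∑ v ∈ S.filter (fun v => H ≤ f v), 1 / H := by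
              refine Finset.sum_le_sum fun v hv => ?_
              have := (Finset.mem_filter.1 hv).2
              gcongr
          _ = ((S.filter fun v => H ≤ f v).card : ℝ) / H := by
              rw [Finset.sum_const, nsmul_eq_mul]; ring
          _ ≤ K * H ^ (1 + ε) / H := by gcongr
          _ = K * H ^ ε := by
              rw [Real.rpow_add hH, Real.rpow_one]; field_simp
      have h6 : (H / 2) ^ ε = H ^ ε * 2 ^ (-ε) := by
        rw [Real.div_rpow hH.le (by norm_num), Real.rpow_neg (by norm_num)]; rfl
      rw [h6] at h3
      have h7 : K * H ^ ε * (1 / (1 - 2 ^ (-ε))) =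
          K * H ^ ε + K * (H ^ ε * 2 ^ (-ε)) * (1 / (1 - 2 ^ (-ε))) := by
        have : (1 : ℝ) - 2 ^ (-ε) ≠ 0 := by linarith
        field_simp
        ring
      rw [h7]
      linarith
  obtain ⟨n, hn⟩ := pow_unbounded_of_one_lt (2 * H₀) (by norm_num : (1 : ℝ) < 2)
  exact main n H₀ hH₀ le_rfl (by linarith) W subset_rfl
    (fun v hv => by have := hfH v hv; linarith)

lemma one_half_lt_of_near {E : Set Contact} {U κ : ℝ} {v : ℤ × ℤ × ℤ} (hU : 0 < U)
    (h : Near E U κ v) : 1 / 2 < U := by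
  have h1 : (0 : ℝ) < v.1 := hU.trans_le h.1
  have h2 : (1 : ℤ) ≤ v.1 := by exact_mod_cast h1
  have h3 : (1 : ℝ) ≤ v.1 := by exact_mod_cast h2
  linarith [h.2.1]

/-- Primitive integer points near the cone over a convex arc, close to the critical scale. -/
lemma exists_primitive_bound {C R ε : ℝ} (hC : 1 ≤ C) (hR : 0 ≤ R) (hε : 0 < ε) :
    ∃ κ K : ℝ, 0 < κ ∧ κ < 1 ∧ 0 < K ∧ ∀ E : Set Contact, IsConvexArc C R E →
      ∀ U : ℝ, 0 < U → ∀ κ' : ℝ, 0 < κ' → κ' ≤ κ → ∀ S : Finset (ℤ × ℤ × ℤ),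
      (∀ v ∈ S, Near E U κ' v) → (∀ v ∈ S, vgcd v = 1) →
      (S.card : ℝ) ≤ K * (U + κ' * U ^ (1 + ε)) := by
  have h2 := two_rpow_neg_lt_one hε
  obtain ⟨c, hc⟩ : ∃ c : ℝ, c = 1 / (1 - 2 ^ (-ε)) := ⟨_, rfl⟩
  have hc1 : 1 ≤ c := by
    rw [hc, le_div_iff₀ (by linarith)]
    have : (0 : ℝ) < 2 ^ (-ε) := by positivity
    linarith
  obtain ⟨M, hM⟩ : ∃ M : ℝ, M = 4 * C ^ 2 + 2 := ⟨_, rfl⟩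
  have hM6 : 6 ≤ M := by rw [hM]; nlinarith
  have hMc : 6 ≤ M * c := by nlinarith
  have hCM : 6 ≤ C * M := by nlinarith
  obtain ⟨κ, hκdef⟩ : ∃ κ : ℝ, κ = 1 / (1100 * C * M * c) := ⟨_, rfl⟩
  have hκ : 0 < κ := by rw [hκdef]; positivity
  have hκ1 : κ * (1100 * C * M * c) = 1 := by rw [hκdef]; field_simp
  have k1 : 1100 * C * κ ≤ 1 := by
    have : 1100 * C * κ * 1 ≤ 1100 * C * κ * (M * c) := by gcongr; linarith
    linarith
  have k2 : 704 * C * M * κ ≤ 1 := by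
    have : 704 * C * M * κ * 1 ≤ 704 * C * M * κ * c := by gcongr
    have : 0 < C * M * κ * c := by positivity
    linarith
  have k3 : 32 * M * c * κ ≤ 1 := by
    have : 32 * M * c * κ * 1 ≤ 32 * M * c * κ * C := by gcongr
    have : 0 < C * M * κ * c := by positivity
    linarith
  have k4 : 8 * M * κ ≤ 1 := by
    have : 8 * M * κ * 1 ≤ 8 * M * κ * C := by gcongr
    have : 0 < C * M * κ := by positivity
    linarith
  have k5 : κ < 1 := by nlinarith
  have step : ∀ K : ℝ, 0 < K → ∀ E : Set Contact, IsConvexArc C R E →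
      ∀ U : ℝ, 0 < U → ∀ κ' : ℝ, 0 < κ' → κ' ≤ κ →
      (∀ E : Set Contact, IsConvexArc C R E → ∀ D : ℝ, 0 < D → D ≤ U / 2 →
        ∀ S : Finset (ℤ × ℤ × ℤ), (∀ v ∈ S, Near E D κ v) → (∀ v ∈ S, vgcd v = 1) →
        (S.card : ℝ) ≤ K * D ^ (1 + ε)) → ∀ S : Finset (ℤ × ℤ × ℤ),
      (∀ v ∈ S, Near E U κ' v) → (∀ v ∈ S, vgcd v = 1) →
      (S.card : ℝ) ≤ (8 * R / κ + 32) * U + 16 * M * c * κ' * (K * U ^ (1 + ε)) := by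
    intro K hK E hE U hU κ' hκ' hκκ ih S hS hg
    rcases S.eq_empty_or_nonempty with rfl | ⟨v₀, hv₀⟩
    · rw [Finset.card_empty, Nat.cast_zero]; positivity
    have hU2 := one_half_lt_of_near hU (hS v₀ hv₀)
    obtain ⟨L, hL, hcard⟩ := hE.card_le_sum_lines hC hR hU hκ' hκκ k1 hS hg
    rw [← hM] at hL hcard
    have hsum : ∑ n ∈ L, 1 / (n.1 : ℝ) ≤ K * (4 * M * U * κ') ^ ε * c := by
      rw [hc]
      refine sum_inv_le_of_dyadic (f := fun n : ℤ × ℤ × ℤ => (n.1 : ℝ)) hK.le hε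
        (fun n hn => by exact_mod_cast (hL n hn).2.1) (fun n hn => (hL n hn).2.2.1)
        (by positivity) (fun D hD hDH T hTL hT => ?_)
      refine ih (dualArc E) hE.dual D hD ?_ T (fun n hn => ?_) (fun n hn => (hL n (hTL hn)).1)
      · have : 4 * M * U * κ' ≤ 4 * M * U * κ := by gcongr
        nlinarith
      · obtain ⟨-, hn0, hnH, e, he, he1, he2⟩ := hL n (hTL hn)
        refine ⟨(hT n hn).1, (hT n hn).2, e, he, he1.trans (by nlinarith), he2.trans ?_⟩
        rw [div_le_div_iff₀ hU hD]
        have a1 : D ≤ 4 * M * U * κ := hDH.trans (by gcongr)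
        calc 176 * C * κ ^ 3 * D ≤ 176 * C * κ ^ 3 * (4 * M * U * κ) := by gcongr
          _ = κ ^ 2 * U * κ * (704 * C * M * κ) := by ring
          _ ≤ κ ^ 2 * U * κ * 1 := by gcongr
          _ ≤ κ ^ 2 * U * 1 * 1 := by gcongr
          _ = κ ^ 2 * U := by ring
    have hpow : (4 * M * U * κ') ^ ε ≤ U ^ ε := by
      apply Real.rpow_le_rpow (by positivity) _ hε.le
      have : 4 * M * U * κ' ≤ 4 * M * U * κ := by gcongr
      nlinarith
    have e1 : U ^ (1 + ε) = U * U ^ ε := by rw [Real.rpow_add hU, Real.rpow_one]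
    have h5 : 16 * M * U * κ' * ∑ n ∈ L, 1 / (n.1 : ℝ) ≤ 16 * M * c * κ' * (K * U ^ (1 + ε)) := by
      calc 16 * M * U * κ' * ∑ n ∈ L, 1 / (n.1 : ℝ) ≤ 16 * M * U * κ' * (K * U ^ ε * c) := by
            gcongr
            exact hsum.trans (by gcongr)
        _ = _ := by rw [e1]; ring
    have h6 : 4 * (2 * (R * U / κ) + 4) ≤ (8 * R / κ + 32) * U := by
      have : 4 * (2 * (R * U / κ) + 4) = 8 * R / κ * U + 16 := by ring
      rw [this]
      linarith
    linarith
  obtain ⟨K, hKdef⟩ : ∃ K : ℝ, K = 2 * ((8 * R / κ + 32) * 2 ^ ε) := ⟨_, rfl⟩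
  have hK : 0 < K := by rw [hKdef]; positivity
  have main : ∀ n : ℕ, ∀ E : Set Contact, IsConvexArc C R E → ∀ U : ℝ, 0 < U → U ≤ 2 ^ n / 2 →
      ∀ S : Finset (ℤ × ℤ × ℤ), (∀ v ∈ S, Near E U κ v) → (∀ v ∈ S, vgcd v = 1) →
      (S.card : ℝ) ≤ K * U ^ (1 + ε) := by
    intro n
    induction n with
    | zero =>
      intro E hE U hU hUn S hS hg
      rcases S.eq_empty_or_nonempty with rfl | ⟨v₀, hv₀⟩
      · rw [Finset.card_empty, Nat.cast_zero]; positivity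
      have hU2 := one_half_lt_of_near hU (hS v₀ hv₀)
      norm_num at hUn
      linarith
    | succ n ihn =>
      intro E hE U hU hUn S hS hg
      rcases S.eq_empty_or_nonempty with rfl | ⟨v₀, hv₀⟩
      · rw [Finset.card_empty, Nat.cast_zero]; positivity
      have hU2 := one_half_lt_of_near hU (hS v₀ hv₀)
      have h7 := step K hK E hE U hU κ hκ le_rfl (fun E' hE' D hD hDU => ihn E' hE' D hD
        (by rw [pow_succ] at hUn; linarith)) S hS hg
      have e1 : U ^ (1 + ε) = U * U ^ ε := by rw [Real.rpow_add hU, Real.rpow_one]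
      have h8 : 1 ≤ 2 ^ ε * U ^ ε := by
        rw [← Real.mul_rpow (by norm_num) hU.le]
        exact Real.one_le_rpow (by linarith) hε.le
      have h9 : (8 * R / κ + 32) * U ≤ K / 2 * U ^ (1 + ε) := by
        rw [hKdef, e1]
        calc (8 * R / κ + 32) * U = (8 * R / κ + 32) * U * 1 := by ring
          _ ≤ (8 * R / κ + 32) * U * (2 ^ ε * U ^ ε) := by gcongr
          _ = _ := by ring
      have h10 : 16 * M * c * κ * (K * U ^ (1 + ε)) ≤ 1 / 2 * (K * U ^ (1 + ε)) := by
        gcongr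
        linarith
      linarith
  refine ⟨κ, (8 * R / κ + 32) + 16 * M * c * K, hκ, k5, by positivity,
    fun E hE U hU κ' hκ' hκκ S hS hg => ?_⟩
  have h7 := step K hK E hE U hU κ' hκ' hκκ (fun E' hE' D hD hDU S hS hg => by
    obtain ⟨n, hn⟩ := pow_unbounded_of_one_lt (2 * D) (by norm_num : (1 : ℝ) < 2)
    exact main n E' hE' D hD (by linarith) S hS hg) S hS hg
  refine h7.trans ?_
  have p1 : 0 ≤ 16 * M * c * K * U := by positivity
  have p2 : 0 ≤ (8 * R / κ + 32) * (κ' * U ^ (1 + ε)) := by positivity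
  linarith

lemma Near.div {E : Set Contact} {U κ : ℝ} {g : ℕ} (hg : 0 < g) {w : ℤ × ℤ × ℤ}
    (h : Near E U κ ((g : ℤ) * w.1, (g : ℤ) * w.2.1, (g : ℤ) * w.2.2)) :
    Near E (U / g) (κ / g) w := by
  obtain ⟨h1, h2, e, he, h3, h4⟩ := h
  have hg' : (0 : ℝ) < g := by exact_mod_cast hg
  rw [hoff_mul, abs_mul, Int.cast_natCast, Nat.abs_cast] at h3
  rw [voff_mul, abs_mul, Int.cast_natCast, Nat.abs_cast] at h4
  push_cast at h1 h2
  refine ⟨?_, ?_, e, he, ?_, ?_⟩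
  · rw [div_le_iff₀ hg']; linarith
  · rw [← mul_div_assoc, lt_div_iff₀ hg']; linarith
  · rw [le_div_iff₀ hg']; linarith
  · have : (κ / g) ^ 2 / (U / g) = κ ^ 2 / U / g := by field_simp
    rw [this, le_div_iff₀ hg']; linarith

lemma sum_inv_sq_le (N : ℕ) : ∑ g ∈ Finset.Icc 1 N, 1 / (g : ℝ) ^ 2 ≤ 2 - 1 / (N : ℝ) := by
  induction N with
  | zero => norm_num
  | succ n ih =>
    rw [Finset.sum_Icc_succ_top (by omega)]
    rcases n.eq_zero_or_pos with rfl | hn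
    · norm_num
    have hn' : (0 : ℝ) < n := by exact_mod_cast hn
    push_cast
    have h : 1 / ((n : ℝ) + 1) ^ 2 ≤ 1 / n - 1 / (n + 1) := by
      rw [div_sub_div _ _ hn'.ne' (by positivity), div_le_div_iff₀ (by positivity) (by positivity)]
      nlinarith
    linarith

/-- Integer points near the cone over a convex arc, close to the critical scale. -/
lemma exists_critical_bound {C R ε : ℝ} (hC : 1 ≤ C) (hR : 0 ≤ R) (hε : 0 < ε) :
    ∃ κ K : ℝ, 0 < κ ∧ κ < 1 ∧ 0 < K ∧ ∀ E : Set Contact, IsConvexArc C R E →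
      ∀ U : ℝ, 1 / 2 ≤ U → ∀ κ' : ℝ, 0 < κ' → κ' ≤ κ → ∀ S : Finset (ℤ × ℤ × ℤ),
      (∀ v ∈ S, Near E U κ' v) →
      (S.card : ℝ) ≤ K * (U * (1 + Real.log (2 * U)) + κ' * U ^ (1 + ε)) := by
  obtain ⟨κ, K, hκ, hκ1, hK, hb⟩ := exists_primitive_bound hC hR hε
  refine ⟨κ, 2 * K, hκ, hκ1, by positivity, fun E hE U hU κ' hκ' hκκ S hS => ?_⟩
  have hU0 : 0 < U := by linarith
  have pos : ∀ v ∈ S, 0 < v.1 := fun v hv => by exact_mod_cast hU0.trans_le (hS v hv).1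
  have hmaps : ∀ v ∈ S, vgcd v ∈ Finset.Icc 1 ⌊2 * U⌋₊ := by
    intro v hv
    have h1 : 0 < vgcd v := Int.gcd_pos_of_ne_zero_left _ (pos v hv).ne'
    have h2 : (vgcd v : ℤ) ≤ v.1 := Int.le_of_dvd (pos v hv) (Int.gcd_dvd_left _ _)
    have h3 : (vgcd v : ℝ) ≤ v.1 := by exact_mod_cast h2
    exact Finset.mem_Icc.2 ⟨h1, Nat.le_floor (h3.trans (hS v hv).2.1.le)⟩
  have hfib : ∀ g ∈ Finset.Icc 1 ⌊2 * U⌋₊, ((S.filter fun v => vgcd v = g).card : ℝ) ≤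
      K * (U * (1 / g) + κ' * U ^ (1 + ε) * (1 / (g : ℝ) ^ 2)) := by
    intro g hg
    have hg1 := (Finset.mem_Icc.1 hg).1
    have hg0 : (0 : ℝ) < g := by exact_mod_cast hg1
    have hg1' : (1 : ℝ) ≤ g := by exact_mod_cast hg1
    have : ∀ v ∈ S.filter fun v => vgcd v = g, ∃ w : ℤ × ℤ × ℤ, vgcd w = 1 ∧
        v = ((g : ℤ) * w.1, (g : ℤ) * w.2.1, (g : ℤ) * w.2.2) := by
      intro v hv
      obtain ⟨hvS, rfl⟩ := Finset.mem_filter.1 hv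
      exact exists_eq_mul_vgcd (pos v hvS).ne'
    choose! q hq hvq using this
    have hinj : Set.InjOn q (S.filter fun v => vgcd v = g) := by
      intro v hv w hw hvw
      rw [hvq v hv, hvq w hw, hvw]
    rw [← Finset.card_image_of_injOn hinj]
    have h1 := hb E hE (U / g) (by positivity) (κ' / g) (by positivity)
      ((div_le_self hκ'.le hg1').trans hκκ) ((S.filter fun v => vgcd v = g).image q) ?_ ?_
    · refine h1.trans ?_
      have h2 : (U / g) ^ (1 + ε) ≤ U ^ (1 + ε) / g := by
        rw [Real.div_rpow hU0.le hg0.le]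
        gcongr
        calc (g : ℝ) = (g : ℝ) ^ (1 : ℝ) := (Real.rpow_one _).symm
          _ ≤ _ := Real.rpow_le_rpow_of_exponent_le hg1' (by linarith)
      have h3 : κ' / g * (U / g) ^ (1 + ε) ≤ κ' / g * (U ^ (1 + ε) / g) := by gcongr
      have h4 : κ' / g * (U ^ (1 + ε) / g) = κ' * U ^ (1 + ε) * (1 / (g : ℝ) ^ 2) := by
        field_simp
      rw [h4] at h3
      rw [mul_one_div]
      gcongr
    · intro w hw
      obtain ⟨v, hv, rfl⟩ := Finset.mem_image.1 hw
      refine Near.div hg1 ?_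
      rw [← hvq v hv]
      exact hS v (Finset.mem_filter.1 hv).1
    · intro w hw
      obtain ⟨v, hv, rfl⟩ := Finset.mem_image.1 hw
      exact hq v hv
  have hharm : ∑ g ∈ Finset.Icc 1 ⌊2 * U⌋₊, 1 / (g : ℝ) ≤ 1 + Real.log (2 * U) := by
    have h1 := harmonic_floor_le_one_add_log (2 * U) (by linarith)
    rw [harmonic_eq_sum_Icc] at h1
    push_cast at h1
    simpa using h1
  have hsq : ∑ g ∈ Finset.Icc 1 ⌊2 * U⌋₊, 1 / (g : ℝ) ^ 2 ≤ 2 :=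
    (sum_inv_sq_le _).trans (by
      have : 0 ≤ 1 / (⌊2 * U⌋₊ : ℝ) := by positivity
      linarith)
  have hlog : 0 ≤ Real.log (2 * U) := Real.log_nonneg (by linarith)
  calc (S.card : ℝ) = ∑ g ∈ Finset.Icc 1 ⌊2 * U⌋₊, ((S.filter fun v => vgcd v = g).card : ℝ) := by
        exact_mod_cast Finset.card_eq_sum_card_fiberwise hmaps
    _ ≤ ∑ g ∈ Finset.Icc 1 ⌊2 * U⌋₊,
          K * (U * (1 / g) + κ' * U ^ (1 + ε) * (1 / (g : ℝ) ^ 2)) := Finset.sum_le_sum hfib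
    _ = K * (U * ∑ g ∈ Finset.Icc 1 ⌊2 * U⌋₊, 1 / (g : ℝ) +
          κ' * U ^ (1 + ε) * ∑ g ∈ Finset.Icc 1 ⌊2 * U⌋₊, 1 / (g : ℝ) ^ 2) := by
        rw [← Finset.mul_sum, Finset.sum_add_distrib, Finset.mul_sum, Finset.mul_sum]
    _ ≤ K * (U * (1 + Real.log (2 * U)) + κ' * U ^ (1 + ε) * 2) := by gcongr
    _ ≤ _ := by
        have : 0 ≤ K * (U * (1 + Real.log (2 * U))) := by positivity
        linarith

lemma one_add_log_le {ε U : ℝ} (hε : 0 < ε) (hU : 1 / 2 ≤ U) :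
    1 + Real.log (2 * U) ≤ (1 + 1 / ε) * 2 ^ ε * U ^ ε := by
  have h1 := Real.log_le_rpow_div (by linarith : 0 ≤ 2 * U) hε
  have h2 : 1 ≤ (2 * U) ^ ε := Real.one_le_rpow (by linarith) hε.le
  rw [mul_assoc, ← Real.mul_rpow (by norm_num) (by linarith), add_mul, one_mul, one_div_mul_eq_div]
  linarith

lemma hoff_sub (e : Contact) (v w : ℤ × ℤ × ℤ) : e.hoff (v - w) = e.hoff v - e.hoff w := by
  simp only [hoff, Prod.fst_sub, Prod.snd_sub]; push_cast; ring

lemma voff_sub (e : Contact) (v w : ℤ × ℤ × ℤ) : e.voff (v - w) = e.voff v - e.voff w := by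
  simp only [voff, Prod.fst_sub, Prod.snd_sub]; push_cast; ring

lemma abs_sub_lt_of_floor_div_eq {x y l : ℝ} (hl : 0 < l) (h : ⌊x / l⌋ = ⌊y / l⌋) :
    |x - y| < l := by
  have h1 := Int.abs_sub_lt_one_of_floor_eq_floor h
  rwa [← sub_div, abs_div, abs_of_pos hl, div_lt_one hl] at h1

lemma card_image_floor_div_le {ι : Type*} (T : Finset ι) (f : ι → ℝ) {a B l : ℝ} (hl : 0 < l)
    (hf : ∀ v ∈ T, |f v - a| ≤ B) (hB : 0 ≤ B) :
    ((T.image fun v => ⌊f v / l⌋).card : ℝ) ≤ 2 * (B / l) + 2 := by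
  refine card_image_floor_le T (fun v => f v / l) (a := a / l) (fun v hv => ?_) (by positivity)
  rw [← sub_div, abs_div, abs_of_pos hl]
  have := hf v hv
  gcongr

/-- Splitting a set of integer vectors into boxes and passing to differences. -/
lemma exists_differences (f : ℤ × ℤ × ℤ →+ ℤ) (e : Contact) {U A B lu la lb : ℝ} (hU : 0 < U)
    (hA : 0 ≤ A) (hB : 0 ≤ B) (hlu : 0 < lu) (hla : 0 < la) (hlb : 0 < lb)
    {T : Finset (ℤ × ℤ × ℤ)} (hTu : ∀ v ∈ T, U ≤ v.1 ∧ (v.1 : ℝ) < 2 * U)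
    (hTa : ∀ v ∈ T, |e.hoff v| ≤ A) (hTb : ∀ v ∈ T, |e.voff v| ≤ B) :
    ∃ D : Finset (ℤ × ℤ × ℤ),
      (∀ d ∈ D, d ≠ 0 ∧ 0 ≤ f d ∧ |(d.1 : ℝ)| < lu ∧ |e.hoff d| < la ∧ |e.voff d| < lb) ∧
      (T.card : ℝ) ≤
        (U / lu + 2) * (2 * (A / la) + 2) * (2 * (B / lb) + 2) * (1 + (D.card : ℝ)) := by
  classical
  set D := ((T ×ˢ T).image fun q => q.1 - q.2).filter fun d =>
    d ≠ 0 ∧ 0 ≤ f d ∧ |(d.1 : ℝ)| < lu ∧ |e.hoff d| < la ∧ |e.voff d| < lb with hD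
  refine ⟨D, fun d hd => (Finset.mem_filter.1 hd).2, ?_⟩
  set g : ℤ × ℤ × ℤ → ℤ × ℤ × ℤ := fun v =>
    (⌊(v.1 : ℝ) / lu⌋, ⌊e.hoff v / la⌋, ⌊e.voff v / lb⌋) with hg
  have hfib : ∀ b ∈ T.image g, (T.filter fun v => g v = b).card ≤ 1 + D.card := by
    intro b hb
    obtain ⟨v₀, hv₀, rfl⟩ := Finset.mem_image.1 hb
    obtain ⟨w, hw, hmin⟩ := Finset.exists_min_image (T.filter fun v => g v = g v₀) f
      ⟨v₀, Finset.mem_filter.2 ⟨hv₀, rfl⟩⟩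
    rw [← Finset.card_erase_add_one hw, add_comm]
    refine Nat.add_le_add_left (Finset.card_le_card_of_injOn (fun v => v - w) (fun v hv => ?_)
      (fun v _ z _ h => sub_left_injective h)) 1
    obtain ⟨hvw, hv⟩ := Finset.mem_erase.1 hv
    obtain ⟨hv1, hv2⟩ := Finset.mem_filter.1 hv
    obtain ⟨hw1, hw2⟩ := Finset.mem_filter.1 hw
    have hgvw : g v = g w := hv2.trans hw2.symm
    simp only [hg, Prod.mk.injEq] at hgvw
    refine Finset.mem_filter.2 ⟨Finset.mem_image.2 ⟨(v, w), Finset.mk_mem_product hv1 hw1, rfl⟩,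
      sub_ne_zero.2 hvw, ?_, ?_, ?_, ?_⟩
    · rw [map_sub]
      exact sub_nonneg.2 (hmin v hv)
    · rw [Prod.fst_sub, Int.cast_sub]
      exact abs_sub_lt_of_floor_div_eq hlu hgvw.1
    · rw [hoff_sub]
      exact abs_sub_lt_of_floor_div_eq hla hgvw.2.1
    · rw [voff_sub]
      exact abs_sub_lt_of_floor_div_eq hlb hgvw.2.2
  have hu := card_image_floor_div_le T (fun v => (v.1 : ℝ)) hlu (a := 3 / 2 * U) (B := U / 2)
    (fun v hv => abs_le.2 ⟨by linarith [(hTu v hv).1], by linarith [(hTu v hv).2]⟩) (by linarith)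
  have ha := card_image_floor_div_le T e.hoff hla (a := 0)
    (fun v hv => by simpa using hTa v hv) hA
  have hb := card_image_floor_div_le T e.voff hlb (a := 0)
    (fun v hv => by simpa using hTb v hv) hB
  have h1 : (T.image g).card ≤ (T.image fun v => ⌊(v.1 : ℝ) / lu⌋).card *
      ((T.image fun v => ⌊e.hoff v / la⌋).card * (T.image fun v => ⌊e.voff v / lb⌋).card) := by
    rw [← Finset.card_product, ← Finset.card_product]
    refine Finset.card_le_card fun b hb => ?_
    obtain ⟨v, hv, rfl⟩ := Finset.mem_image.1 hb
    simp only [hg, Finset.mem_product]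
    exact ⟨Finset.mem_image_of_mem _ hv, Finset.mem_image_of_mem (fun v => ⌊e.hoff v / la⌋) hv,
      Finset.mem_image_of_mem (fun v => ⌊e.voff v / lb⌋) hv⟩
  have h2 := Finset.card_le_mul_card_image T (1 + D.card) hfib
  calc (T.card : ℝ) ≤ (1 + (D.card : ℝ)) * ((T.image g).card : ℝ) := by exact_mod_cast h2
    _ ≤ (1 + (D.card : ℝ)) * ((T.image fun v => ⌊(v.1 : ℝ) / lu⌋).card *
      ((T.image fun v => ⌊e.hoff v / la⌋).card * (T.image fun v => ⌊e.voff v / lb⌋).card)) := by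
        gcongr
        exact_mod_cast h1
    _ ≤ (1 + (D.card : ℝ)) * ((2 * (U / 2 / lu) + 2) *
        ((2 * (A / la) + 2) * (2 * (B / lb) + 2))) := by gcongr
    _ = _ := by ring

/-- Reduction of the counting problem to short vectors attached to the arcs of the curve. -/
lemma IsConvexArc.exists_short_vectors {C R : ℝ} {E : Set Contact} (h : IsConvexArc C R E)
    (hC : 1 ≤ C) (hR : 0 ≤ R) (f : ℤ × ℤ × ℤ →+ ℤ) {U κ lu la lb : ℝ} (hU : 0 < U) (hκ : 0 < κ)
    (hlu : 0 < lu) (hla : 0 < la) (hlb : 0 < lb) {S : Finset (ℤ × ℤ × ℤ)}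
    (hS : ∀ v ∈ S, Near E U κ v) :
    ∃ (J : Finset ℤ) (e : ℤ → Contact) (D : ℤ → Finset (ℤ × ℤ × ℤ)),
      (J.card : ℝ) ≤ 2 * (R * U / κ) + 4 ∧
      (∀ j ∈ J, e j ∈ E ∧ |(j : ℝ) - (e j).x * (U / κ)| ≤ 2) ∧
      (∀ j ∈ J, ∀ d ∈ D j, d ≠ 0 ∧ 0 ≤ f d ∧ |(d.1 : ℝ)| < lu ∧ |(e j).hoff d| < la ∧
        |(e j).voff d| < lb) ∧
      (S.card : ℝ) ≤ (U / lu + 2) * (2 * (4 * κ / la) + 2) *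
        (2 * (22 * C * κ ^ 2 / U / lb) + 2) * (J.card + ∑ j ∈ J, ((D j).card : ℝ)) := by
  classical
  set g : ℤ × ℤ × ℤ → ℤ := fun v => ⌊xpos v * U / κ⌋ with hg
  have key : ∀ j ∈ S.image g, ∃ (e : Contact) (D : Finset (ℤ × ℤ × ℤ)),
      (e ∈ E ∧ |(j : ℝ) - e.x * (U / κ)| ≤ 2) ∧
      (∀ d ∈ D, d ≠ 0 ∧ 0 ≤ f d ∧ |(d.1 : ℝ)| < lu ∧ |e.hoff d| < la ∧ |e.voff d| < lb) ∧
      ((S.filter fun v => g v = j).card : ℝ) ≤ (U / lu + 2) * (2 * (4 * κ / la) + 2) *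
        (2 * (22 * C * κ ^ 2 / U / lb) + 2) * (1 + (D.card : ℝ)) := by
    intro j hj
    obtain ⟨w, hw, rfl⟩ := Finset.mem_image.1 hj
    obtain ⟨hw1, hw2, e, he, hw3, hw4⟩ := hS w hw
    have hb : ∀ v ∈ S.filter fun v => g v = g w, |e.hoff v| ≤ 4 * κ ∧
        |e.voff v| ≤ 22 * C * κ ^ 2 / U := fun v hv =>
      h.near_bounds hC hU hκ (hS v (Finset.mem_filter.1 hv).1) hw1
        (abs_xpos_sub_le_of_floor_eq hU hκ (Finset.mem_filter.1 hv).2) he hw3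
    obtain ⟨D, hD, hcard⟩ := exists_differences f e hU (by positivity : 0 ≤ 4 * κ)
      (by positivity : 0 ≤ 22 * C * κ ^ 2 / U) hlu hla hlb
      (fun v hv => ⟨(hS v (Finset.mem_filter.1 hv).1).1, (hS v (Finset.mem_filter.1 hv).1).2.1⟩)
      (fun v hv => (hb v hv).1) (fun v hv => (hb v hv).2)
    refine ⟨e, D, ⟨he, ?_⟩, hD, hcard⟩
    have h1 : |xpos w * U / κ - e.x * (U / κ)| ≤ 1 := by
      have h2 : xpos w * U / κ - e.x * (U / κ) = (xpos w - e.x) * (U / κ) := by ring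
      rw [h2, abs_mul, abs_of_pos (by positivity : 0 < U / κ)]
      calc |xpos w - e.x| * (U / κ) ≤ κ / U * (U / κ) := by
            gcongr
            exact abs_xpos_sub_le hU hw1 hw3
        _ = 1 := by field_simp
    have h3 := Int.floor_le (xpos w * U / κ)
    have h4 := Int.lt_floor_add_one (xpos w * U / κ)
    rw [abs_le] at h1 ⊢
    constructor <;> simp only [hg] <;> linarith
  have : Nonempty Contact := ⟨⟨0, 0, 0⟩⟩
  choose! e D he hD hcard using key
  refine ⟨S.image g, e, D, h.card_image_arc_le hR hU hκ hS, he, hD, ?_⟩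
  calc (S.card : ℝ) = ∑ j ∈ S.image g, ((S.filter fun v => g v = j).card : ℝ) := by
        exact_mod_cast Finset.card_eq_sum_card_image g S
    _ ≤ ∑ j ∈ S.image g, (U / lu + 2) * (2 * (4 * κ / la) + 2) *
        (2 * (22 * C * κ ^ 2 / U / lb) + 2) * (1 + ((D j).card : ℝ)) :=
        Finset.sum_le_sum hcard
    _ = _ := by
        rw [← Finset.mul_sum, Finset.sum_add_distrib, Finset.sum_const, nsmul_eq_mul, mul_one]

lemma sum_card_eq_sum_biUnion {ι α : Type*} [DecidableEq α] (J : Finset ι) (D : ι → Finset α) :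
    ∑ j ∈ J, ((D j).card : ℝ) =
      ∑ d ∈ J.biUnion D, ((J.filter fun j => d ∈ D j).card : ℝ) := by
  have h := Finset.sum_card_bipartiteAbove_eq_sum_card_bipartiteBelow (s := J) (t := J.biUnion D)
    (fun j d => d ∈ D j)
  have h1 : ∀ j ∈ J, (D j).card =
      (Finset.bipartiteAbove (fun j d => d ∈ D j) (J.biUnion D) j).card := by
    intro j hj
    congr 1
    ext d
    simp only [Finset.bipartiteAbove, Finset.mem_filter, Finset.mem_biUnion]
    exact ⟨fun hd => ⟨⟨j, hj, hd⟩, hd⟩, fun hd => hd.2⟩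
  rw [← Finset.sum_congr rfl h1] at h
  exact_mod_cast h

lemma card_int_le (T : Finset ℤ) {a B : ℝ} (hT : ∀ j ∈ T, |(j : ℝ) - a| ≤ B) (hB : 0 ≤ B) :
    (T.card : ℝ) ≤ 2 * B + 2 := by
  have := card_image_floor_le T (fun j : ℤ => (j : ℝ)) hT hB
  simpa using this

lemma int_eq_zero_of_abs_lt_one {n : ℤ} (h : |(n : ℝ)| < 1) : n = 0 := by
  rw [← Int.abs_lt_one_iff]
  exact_mod_cast h

set_option maxHeartbeats 1000000 in
/-- Integer points near the cone over a convex arc, above the critical scale. -/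
lemma exists_supercritical_bound {C R ε κ K : ℝ} (hC : 1 ≤ C) (hR : 0 ≤ R) (hε : 0 < ε)
    (hκ : 0 < κ) (hκ1 : κ < 1) (hK : 0 < K)
    (hcrit : ∀ E : Set Contact, IsConvexArc C R E → ∀ U : ℝ, 1 / 2 ≤ U →
      ∀ S : Finset (ℤ × ℤ × ℤ), (∀ v ∈ S, Near E U κ v) → (S.card : ℝ) ≤ K * U ^ (1 + ε)) :
    ∃ K' : ℝ, 0 < K' ∧ ∀ E : Set Contact, IsConvexArc C R E → ∀ U κ₁ : ℝ, 0 < U → κ ≤ κ₁ → κ₁ ≤ U →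
      ∀ S : Finset (ℤ × ℤ × ℤ), (∀ v ∈ S, Near E U κ₁ v) →
      (S.card : ℝ) ≤ K' * (κ₁ ^ 2 * U * (U / κ₁) ^ ε) := by
  classical
  have h2 := two_rpow_neg_lt_one hε
  obtain ⟨c, hc⟩ : ∃ c : ℝ, c = 1 / (1 - 2 ^ (-ε)) := ⟨_, rfl⟩
  have hc0 : 0 < c := by
    rw [hc]
    exact one_div_pos.2 (by linarith)
  refine ⟨1380 * C / κ ^ 3 * (2 * R + 4 + 8 * (K * c)), by positivity,
    fun E hE U κ₁ hU hκκ hκU S hS => ?_⟩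
  have hκ₁ := hκ.trans_le hκκ
  obtain ⟨H, hH⟩ : ∃ H : ℝ, H = κ * U / κ₁ := ⟨_, rfl⟩
  obtain ⟨b, hb⟩ : ∃ b : ℝ, b = κ * κ₁ / U := ⟨_, rfl⟩
  have hH0 : 0 < H := by rw [hH]; positivity
  have hb0 : 0 < b := by rw [hb]; positivity
  have hbκ : b ≤ κ := by
    rw [hb, div_le_iff₀ hU]
    gcongr
  have hbH : b = κ ^ 2 / H := by rw [hb, hH]; field_simp
  have hHU : H ≤ U / κ₁ := by
    rw [hH, mul_div_assoc]
    exact mul_le_of_le_one_left (by positivity) hκ1.le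
  have hUκ : 1 ≤ U / κ₁ := (one_le_div hκ₁).2 hκU
  obtain ⟨J, e, D, hJ, he, hD, hcard⟩ := hE.exists_short_vectors hC hR
    (AddMonoidHom.fst ℤ (ℤ × ℤ)) hU hκ₁ hH0 hκ hb0 hS
  rw [sum_card_eq_sum_biUnion] at hcard
  set W := J.biUnion D with hW
  have hpos : ∀ j ∈ J, ∀ d ∈ D j, (1 : ℝ) ≤ d.1 ∧ (d.1 : ℝ) ≤ H := by
    intro j hj d hd
    obtain ⟨hd0, hd1, hd2, hd3, hd4⟩ := hD j hj d hd
    simp only [AddMonoidHom.coe_fst] at hd1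
    refine ⟨?_, (le_abs_self _).trans hd2.le⟩
    rcases hd1.eq_or_lt with h0 | h0
    · exfalso
      obtain ⟨u, t, r⟩ := d
      simp only at h0
      subst h0
      have ht : t = 0 := int_eq_zero_of_abs_lt_one (by
        simp only [hoff, Int.cast_zero, zero_mul, sub_zero] at hd3
        linarith)
      subst ht
      have hr : r = 0 := int_eq_zero_of_abs_lt_one (by
        simp only [voff, Int.cast_zero, zero_mul, sub_zero, mul_zero] at hd4
        linarith)
      subst hr
      exact hd0 rfl
    · exact_mod_cast h0
  have hposW : ∀ d ∈ W, (1 : ℝ) ≤ d.1 ∧ (d.1 : ℝ) ≤ H := by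
    intro d hd
    obtain ⟨j, hj, hjd⟩ := Finset.mem_biUnion.1 hd
    exact hpos j hj d hjd
  have hmult : ∀ d ∈ W, ((J.filter fun j => d ∈ D j).card : ℝ) ≤ 8 * H * (1 / d.1) := by
    intro d hd
    obtain ⟨hd1, hdH⟩ := hposW d hd
    have hd0 : (0 : ℝ) < d.1 := by linarith
    have h3 := card_int_le (J.filter fun j => d ∈ D j) (a := xpos d * (U / κ₁)) (B := 2 + H / d.1)
      (fun j hj => ?_) (by positivity)
    · have : 1 ≤ H / d.1 := (one_le_div hd0).2 hdH
      rw [mul_one_div, mul_div_assoc]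
      linarith
    · obtain ⟨hj, hjd⟩ := Finset.mem_filter.1 hj
      have h4 := (he j hj).2
      have h5 := abs_xpos_sub_le hd0 le_rfl (hD j hj d hjd).2.2.2.1.le
      have h6 : |(e j).x * (U / κ₁) - xpos d * (U / κ₁)| ≤ H / d.1 := by
        rw [← sub_mul, abs_mul, abs_of_pos (by positivity : 0 < U / κ₁), abs_sub_comm]
        calc |xpos d - (e j).x| * (U / κ₁) ≤ κ / d.1 * (U / κ₁) := by gcongr
          _ = _ := by rw [hH]; field_simp
      exact (abs_sub_le _ _ _).trans (add_le_add h4 h6)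
  have hsum : ∑ d ∈ W, 1 / (d.1 : ℝ) ≤ K * H ^ ε * c := by
    rw [hc]
    refine sum_inv_le_of_dyadic (f := fun d : ℤ × ℤ × ℤ => (d.1 : ℝ)) hK.le hε
      (fun d hd => (hposW d hd).1) (fun d hd => (hposW d hd).2) hH0 (fun Δ hΔ hΔH T hTW hT => ?_)
    rcases T.eq_empty_or_nonempty with rfl | ⟨v₀, hv₀⟩
    · rw [Finset.card_empty, Nat.cast_zero]; positivity
    have hΔ2 : 1 / 2 ≤ Δ := by linarith [(hT v₀ hv₀).2, (hposW v₀ (hTW hv₀)).1]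
    refine hcrit E hE Δ hΔ2 T fun d hd => ?_
    obtain ⟨j, hj, hjd⟩ := Finset.mem_biUnion.1 (hTW hd)
    obtain ⟨-, -, -, hd3, hd4⟩ := hD j hj d hjd
    refine ⟨(hT d hd).1, (hT d hd).2, e j, (he j hj).1, hd3.le, hd4.le.trans ?_⟩
    rw [hbH]
    gcongr
  obtain ⟨Y, hY⟩ : ∃ Y : ℝ, Y = U / κ₁ := ⟨_, rfl⟩
  rw [← hY] at hHU hUκ
  have hYε : 1 ≤ Y ^ ε := Real.one_le_rpow hUκ hε.le
  have hJ' : (J.card : ℝ) ≤ (2 * R + 4) * (Y * Y ^ ε) := by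
    rw [mul_div_assoc, ← hY] at hJ
    have : Y * 1 ≤ Y * Y ^ ε := by gcongr
    calc (J.card : ℝ) ≤ 2 * (R * Y) + 4 := hJ
      _ ≤ (2 * R + 4) * (Y * 1) := by linarith
      _ ≤ _ := by gcongr
  have hD' : ∑ d ∈ W, ((J.filter fun j => d ∈ D j).card : ℝ) ≤ 8 * (K * c) * (Y * Y ^ ε) := by
    calc ∑ d ∈ W, ((J.filter fun j => d ∈ D j).card : ℝ)
        ≤ ∑ d ∈ W, 8 * H * (1 / (d.1 : ℝ)) := Finset.sum_le_sum hmult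
      _ = 8 * H * ∑ d ∈ W, 1 / (d.1 : ℝ) := by rw [Finset.mul_sum]
      _ ≤ 8 * H * (K * H ^ ε * c) := by gcongr
      _ ≤ 8 * Y * (K * Y ^ ε * c) := by gcongr
      _ = _ := by ring
  have hbox : (U / H + 2) * (2 * (4 * κ₁ / κ) + 2) * (2 * (22 * C * κ₁ ^ 2 / U / b) + 2) ≤
      1380 * C / κ ^ 3 * κ₁ ^ 3 := by
    obtain ⟨q, hq⟩ : ∃ q : ℝ, q = κ₁ / κ := ⟨_, rfl⟩
    have hq1 : 1 ≤ q := by rw [hq]; exact (one_le_div hκ).2 hκκ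
    have e1 : U / H = q := by rw [hq, hH]; field_simp
    have e2 : 4 * κ₁ / κ = 4 * q := by rw [hq]; ring
    have e3 : 22 * C * κ₁ ^ 2 / U / b = 22 * C * q := by rw [hq, hb]; field_simp
    have e4 : 1380 * C / κ ^ 3 * κ₁ ^ 3 = (3 * q) * (10 * q) * (46 * C * q) := by
      rw [hq]; field_simp; norm_num
    rw [e1, e2, e3, e4]
    have : 1 ≤ C * q := one_le_mul_of_one_le_of_one_le hC hq1
    gcongr <;> linarith
  calc (S.card : ℝ) ≤ _ := hcard
    _ ≤ 1380 * C / κ ^ 3 * κ₁ ^ 3 * ((2 * R + 4) * (Y * Y ^ ε) + 8 * (K * c) * (Y * Y ^ ε)) := by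
        gcongr
    _ = _ := by rw [← hY, hY]; field_simp

set_option maxHeartbeats 1000000 in
/-- Integer points near the cone over a convex arc, in a wide neighbourhood. -/
lemma IsConvexArc.card_le_of_wide {C R : ℝ} {E : Set Contact} (hE : IsConvexArc C R E)
    (hC : 1 ≤ C) (hR : 0 ≤ R) {U κ : ℝ} (hκ1 : 1 ≤ κ) (hκU : κ < U) (hUκ : U ≤ κ ^ 3)
    {S : Finset (ℤ × ℤ × ℤ)} (hS : ∀ v ∈ S, Near E U κ v) :
    (S.card : ℝ) ≤ 1840 * C * (2 * R + 4) * (4 * C + 7) * (κ ^ 2 * U) := by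
  classical
  have hκ : 0 < κ := by linarith
  have hU : 0 < U := by linarith
  obtain ⟨Y, hY⟩ : ∃ Y : ℝ, Y = U / κ := ⟨_, rfl⟩
  have hY1 : 1 < Y := by rw [hY]; exact (one_lt_div hκ).2 hκU
  obtain ⟨s, hs⟩ : ∃ s : ℝ, s = √Y := ⟨_, rfl⟩
  have hs1 : 1 < s := by rw [hs, Real.lt_sqrt (by norm_num)]; linarith
  have hs0 : 0 < s := by linarith
  have hsY : s ^ 2 = Y := by rw [hs]; exact Real.sq_sqrt (by linarith)
  have hsκ : s ≤ κ := by
    refine le_of_sq_le_sq ?_ hκ.le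
    rw [hsY, hY, div_le_iff₀ hκ]
    linarith
  have hinv : 1 / s < 1 := (div_lt_one hs0).2 hs1
  have hsinv : 1 / s * Y = s := by rw [← hsY]; field_simp
  obtain ⟨J, e, D, hJ, he, hD, hcard⟩ := hE.exists_short_vectors hC hR
    ((AddMonoidHom.fst ℤ ℤ).comp (AddMonoidHom.snd ℤ (ℤ × ℤ))) hU hκ
    (by norm_num : (0 : ℝ) < 1 / 2) hs0 (by positivity : 0 < 1 / s) hS
  rw [sum_card_eq_sum_biUnion] at hcard
  rw [← hY] at he
  set W := J.biUnion D with hW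
  have hprop : ∀ j ∈ J, ∀ d ∈ D j, d.1 = 0 ∧ 1 ≤ d.2.1 ∧ (d.2.1 : ℝ) ≤ s ∧
      |(d.2.2 : ℝ) - (e j).p * d.2.1| ≤ 1 / s := by
    intro j hj d hd
    obtain ⟨hd0, hd1, hd2, hd3, hd4⟩ := hD j hj d hd
    simp only [AddMonoidHom.coe_comp, AddMonoidHom.coe_fst, AddMonoidHom.coe_snd,
      Function.comp_apply] at hd1
    obtain ⟨u, t, r⟩ := d
    have hu : u = 0 := int_eq_zero_of_abs_lt_one (by
      simp only at hd2
      linarith)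
    subst hu
    simp only [hoff, voff, Int.cast_zero, zero_mul, sub_zero] at hd1 hd3 hd4 ⊢
    refine ⟨trivial, ?_, (le_abs_self _).trans hd3.le, hd4.le⟩
    rcases hd1.eq_or_lt with h0 | h0
    · exfalso
      subst h0
      have hr : r = 0 := int_eq_zero_of_abs_lt_one (by
        simp only [Int.cast_zero, sub_zero, mul_zero] at hd4
        linarith)
      subst hr
      exact hd0 rfl
    · exact h0
  have hpropW : ∀ d ∈ W, d.1 = 0 ∧ 1 ≤ d.2.1 ∧ (d.2.1 : ℝ) ≤ s ∧
      |(d.2.2 : ℝ)| ≤ R * d.2.1 + 1 := by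
    intro d hd
    obtain ⟨j, hj, hjd⟩ := Finset.mem_biUnion.1 hd
    obtain ⟨h1, h2, h3, h4⟩ := hprop j hj d hjd
    refine ⟨h1, h2, h3, ?_⟩
    have h5 : |(e j).p * (d.2.1 : ℝ)| ≤ R * d.2.1 := by
      have : (0 : ℝ) ≤ d.2.1 := by exact_mod_cast (by omega : 0 ≤ d.2.1)
      rw [abs_mul, abs_of_nonneg this]
      gcongr
      exact hE.p_le _ (he j hj).1
    have h6 := abs_add_le ((d.2.2 : ℝ) - (e j).p * d.2.1) ((e j).p * d.2.1)
    rw [sub_add_cancel] at h6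
    linarith
  have hmult : ∀ d ∈ W, ((J.filter fun j => d ∈ D j).card : ℝ) ≤
      (4 * C + 6) * (s / d.2.1) := by
    intro d hd
    obtain ⟨-, hd1, hds, -⟩ := hpropW d hd
    have hd0 : (0 : ℝ) < d.2.1 := by exact_mod_cast (by omega : 0 < d.2.1)
    have h1 : 1 ≤ s / d.2.1 := (one_le_div hd0).2 hds
    obtain ⟨i, hi, hid⟩ := Finset.mem_biUnion.1 hd
    have h3 := card_int_le (J.filter fun j => d ∈ D j) (a := (e i).x * Y)
      (B := 2 + 2 * C * (s / d.2.1)) (fun j hj => ?_) (by positivity)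
    · linarith
    · obtain ⟨hj, hjd⟩ := Finset.mem_filter.1 hj
      have h4 := (he j hj).2
      have h5 := (hprop j hj d hjd).2.2.2
      have h6 := (hprop i hi d hid).2.2.2
      have h7 : |(e j).p - (e i).p| ≤ 2 * (1 / s) / d.2.1 := by
        rw [le_div_iff₀ hd0]
        calc |(e j).p - (e i).p| * d.2.1
            = |((d.2.2 : ℝ) - (e i).p * d.2.1) - (d.2.2 - (e j).p * d.2.1)| := by
              rw [← abs_of_pos hd0, ← abs_mul, abs_of_pos hd0]; congr 1; ring
          _ ≤ _ := by
              refine (abs_sub _ _).trans ?_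
              linarith
      have h8 := hE.abs_x_sub_le hC (he i hi).1 (he j hj).1
      have h9 : |(e j).x * Y - (e i).x * Y| ≤ 2 * C * (s / d.2.1) := by
        rw [← sub_mul, abs_mul, abs_of_pos (by linarith : 0 < Y)]
        calc |(e j).x - (e i).x| * Y ≤ C * (2 * (1 / s) / d.2.1) * Y := by
              gcongr
              exact h8.trans (by gcongr)
          _ = 2 * C * (1 / s * Y / d.2.1) := by ring
          _ = _ := by rw [hsinv]
      exact (abs_sub_le _ _ _).trans (add_le_add h4 h9)
  have hfib : ∀ t ∈ Finset.Icc 1 ⌊s⌋, ∑ d ∈ W.filter (fun d => d.2.1 = t), s / (d.2.1 : ℝ) ≤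
      (2 * R + 4) * s := by
    intro t ht
    have ht1 : (1 : ℝ) ≤ t := by exact_mod_cast (Finset.mem_Icc.1 ht).1
    have h1 : ((W.filter fun d => d.2.1 = t).card : ℝ) ≤ (2 * R + 4) * t := by
      have hinj : Set.InjOn (fun d : ℤ × ℤ × ℤ => d.2.2) (W.filter fun d => d.2.1 = t) := by
        intro d hd d' hd' hdd
        obtain ⟨hdW, hdt⟩ := Finset.mem_filter.1 hd
        obtain ⟨hdW', hdt'⟩ := Finset.mem_filter.1 hd'
        exact Prod.ext ((hpropW d hdW).1.trans (hpropW d' hdW').1.symm)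
          (Prod.ext (hdt.trans hdt'.symm) hdd)
      rw [← Finset.card_image_of_injOn hinj]
      refine (card_int_le _ (a := 0) (B := R * t + 1) (fun j hj => ?_) (by positivity)).trans ?_
      · obtain ⟨d, hd, rfl⟩ := Finset.mem_image.1 hj
        obtain ⟨hdW, rfl⟩ := Finset.mem_filter.1 hd
        rw [sub_zero]
        exact (hpropW d hdW).2.2.2
      · linarith
    calc ∑ d ∈ W.filter (fun d => d.2.1 = t), s / (d.2.1 : ℝ)
        = ∑ d ∈ W.filter (fun d => d.2.1 = t), s / (t : ℝ) :=
          Finset.sum_congr rfl fun d hd => by rw [(Finset.mem_filter.1 hd).2]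
      _ = ((W.filter fun d => d.2.1 = t).card : ℝ) * (s / t) := by
          rw [Finset.sum_const, nsmul_eq_mul]
      _ ≤ (2 * R + 4) * t * (s / t) := by gcongr
      _ = _ := by field_simp
  have hsum : ∑ d ∈ W, s / (d.2.1 : ℝ) ≤ (2 * R + 4) * Y := by
    rw [← Finset.sum_fiberwise_of_maps_to (g := fun d : ℤ × ℤ × ℤ => d.2.1)
      (t := Finset.Icc 1 ⌊s⌋) (fun d hd => Finset.mem_Icc.2
        ⟨(hpropW d hd).2.1, Int.le_floor.2 (hpropW d hd).2.2.1⟩)]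
    refine (Finset.sum_le_card_nsmul _ _ _ hfib).trans ?_
    rw [nsmul_eq_mul, Int.card_Icc, ← hsY]
    have h1 : (((⌊s⌋ + 1 - 1).toNat : ℕ) : ℝ) ≤ s := by
      have h2 : (((⌊s⌋ + 1 - 1).toNat : ℕ) : ℤ) = ⌊s⌋ := by
        have := Int.floor_nonneg.2 hs0.le
        omega
      have h3 : (((⌊s⌋ + 1 - 1).toNat : ℕ) : ℝ) = ⌊s⌋ := by exact_mod_cast h2
      rw [h3]
      exact Int.floor_le s
    calc (((⌊s⌋ + 1 - 1).toNat : ℕ) : ℝ) * ((2 * R + 4) * s) ≤ s * ((2 * R + 4) * s) := by gcongr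
      _ = _ := by ring
  have hJ' : (J.card : ℝ) ≤ (2 * R + 4) * Y := by
    rw [mul_div_assoc, ← hY] at hJ
    linarith
  have hD' : ∑ d ∈ W, ((J.filter fun j => d ∈ D j).card : ℝ) ≤
      (4 * C + 6) * ((2 * R + 4) * Y) := by
    calc ∑ d ∈ W, ((J.filter fun j => d ∈ D j).card : ℝ)
        ≤ ∑ d ∈ W, (4 * C + 6) * (s / (d.2.1 : ℝ)) := Finset.sum_le_sum hmult
      _ = (4 * C + 6) * ∑ d ∈ W, s / (d.2.1 : ℝ) := by rw [Finset.mul_sum]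
      _ ≤ _ := by gcongr
  have hbox : (U / (1 / 2) + 2) * (2 * (4 * κ / s) + 2) *
      (2 * (22 * C * κ ^ 2 / U / (1 / s)) + 2) ≤ 1840 * C * κ ^ 3 := by
    obtain ⟨q, hq⟩ : ∃ q : ℝ, q = κ / s := ⟨_, rfl⟩
    have hq1 : 1 ≤ q := by rw [hq]; exact (one_le_div hs0).2 hsκ
    have hUs : U = κ * s ^ 2 := by rw [hsY, hY]; field_simp
    have e2 : 4 * κ / s = 4 * q := by rw [hq]; ring
    have e3 : 22 * C * κ ^ 2 / U / (1 / s) = 22 * C * q := by rw [hq, hUs]; field_simp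
    have e4 : 1840 * C * κ ^ 3 = (4 * U) * (10 * q) * (46 * C * q) := by
      rw [hq, hUs]; field_simp; norm_num
    rw [e2, e3, e4]
    have : 1 ≤ C * q := one_le_mul_of_one_le_of_one_le hC hq1
    gcongr <;> linarith
  calc (S.card : ℝ) ≤ _ := hcard
    _ ≤ 1840 * C * κ ^ 3 * ((2 * R + 4) * Y + (4 * C + 6) * ((2 * R + 4) * Y)) := by gcongr
    _ = _ := by rw [hY]; field_simp; ring

/-- Integer points near the cone over a convex arc, at every scale. -/
lemma exists_near_bound {C R ε : ℝ} (hC : 1 ≤ C) (hR : 0 ≤ R) (hε : 0 < ε) :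
    ∃ K : ℝ, 0 < K ∧ ∀ E : Set Contact, IsConvexArc C R E → ∀ δ U : ℝ, 0 < δ → δ < 1 → 1 ≤ U →
      ∀ S : Finset (ℤ × ℤ × ℤ), (∀ v ∈ S, Near E U (√(δ * U)) v) →
      (S.card : ℝ) ≤ K * (δ ^ (1 - ε) * U ^ 2 + U * Real.log (2 * U)) := by
  have hη : 0 < ε / 2 := by linarith
  obtain ⟨κ, K₁, hκ, hκ1, hK₁, hcrit⟩ := exists_critical_bound hC hR hη
  obtain ⟨A, hA⟩ : ∃ A : ℝ, A = (1 + 1 / (ε / 2)) * 2 ^ (ε / 2) := ⟨_, rfl⟩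
  have hA0 : 0 < A := by rw [hA]; positivity
  obtain ⟨K₂, hK₂, hsup⟩ := exists_supercritical_bound (K := K₁ * (A + 1)) hC hR hη hκ hκ1
    (by positivity) (fun E hE U hU S hS => by
      refine (hcrit E hE U hU κ hκ le_rfl S hS).trans ?_
      have hU0 : 0 < U := by linarith
      have h1 := one_add_log_le hη hU
      rw [← hA] at h1
      rw [mul_assoc]
      gcongr
      rw [Real.rpow_add hU0, Real.rpow_one]
      have h2 : U * (1 + Real.log (2 * U)) ≤ U * (A * U ^ (ε / 2)) := by gcongr
      have h3 : κ * (U * U ^ (ε / 2)) ≤ 1 * (U * U ^ (ε / 2)) := by gcongr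
      linarith)
  obtain ⟨K₃, hK₃⟩ : ∃ K₃ : ℝ, K₃ = 1840 * C * (2 * R + 4) * (4 * C + 7) := ⟨_, rfl⟩
  have hK₃0 : 0 < K₃ := by rw [hK₃]; positivity
  refine ⟨5 * K₁ + K₂ + K₃, by positivity, fun E hE δ U hδ hδ1 hU S hS => ?_⟩
  have hU0 : 0 < U := by linarith
  obtain ⟨k, hk⟩ : ∃ k : ℝ, k = √(δ * U) := ⟨_, rfl⟩
  rw [← hk] at hS
  have hk0 : 0 < k := by rw [hk]; positivity
  have hk2 : k ^ 2 = δ * U := by rw [hk]; exact Real.sq_sqrt (by positivity)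
  have hkU : k < U := by
    refine lt_of_pow_lt_pow_left₀ 2 hU0.le ?_
    rw [hk2]
    nlinarith
  have hlog : 1 ≤ 2 * Real.log (2 * U) := by
    have h1 := Real.log_two_gt_d9
    have h2 : Real.log 2 ≤ Real.log (2 * U) := Real.log_le_log (by norm_num) (by linarith)
    linarith
  have hlog0 : 0 < Real.log (2 * U) := by linarith
  obtain ⟨X, hX⟩ : ∃ X : ℝ, X = δ ^ (1 - ε) * U ^ 2 := ⟨_, rfl⟩
  obtain ⟨L, hL⟩ : ∃ L : ℝ, L = U * Real.log (2 * U) := ⟨_, rfl⟩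
  have hX0 : 0 < X := by rw [hX]; positivity
  have hL0 : 0 < L := by rw [hL]; positivity
  have hδε : δ ^ (1 - ε) = δ * (δ⁻¹) ^ ε := by
    rw [Real.rpow_sub hδ, Real.rpow_one, Real.inv_rpow hδ.le]; rfl
  rw [← hX, ← hL]
  have hUL : U ≤ 2 * L := by rw [hL]; nlinarith
  rcases le_or_gt k κ with hkκ | hkκ
  · have h1 := hcrit E hE U (by linarith) k hk0 hkκ S hS
    have h2 : U * (1 + Real.log (2 * U)) ≤ 3 * L := by
      rw [hL] at hUL ⊢
      linarith
    have h3 : k * U ^ (1 + ε / 2) ≤ 2 * L + X := by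
      rw [Real.rpow_add hU0, Real.rpow_one]
      rcases le_or_gt (k * U ^ (ε / 2)) 1 with h4 | h4
      · have : k * (U * U ^ (ε / 2)) = U * (k * U ^ (ε / 2)) := by ring
        rw [this]
        have : U * (k * U ^ (ε / 2)) ≤ U * 1 := by gcongr
        linarith
      · have hUδ : U ≤ δ⁻¹ := by
          rw [← one_div, le_div_iff₀ hδ]
          nlinarith
        calc k * (U * U ^ (ε / 2)) = U * (k * U ^ (ε / 2)) * 1 := by ring
          _ ≤ U * (k * U ^ (ε / 2)) * (k * U ^ (ε / 2)) := by gcongr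
          _ = U * k ^ 2 * (U ^ (ε / 2) * U ^ (ε / 2)) := by ring
          _ = δ * U ^ ε * U ^ 2 := by
            rw [← Real.rpow_add hU0, add_halves, hk2]; ring
          _ ≤ δ * (δ⁻¹) ^ ε * U ^ 2 := by gcongr
          _ = X := by rw [hX, hδε]
          _ ≤ 2 * L + X := by linarith
    calc (S.card : ℝ) ≤ K₁ * (3 * L + (2 * L + X)) := h1.trans (by gcongr)
      _ ≤ _ := by
        have : 0 ≤ K₁ * X := by positivity
        have : 0 ≤ K₂ * (X + L) := by positivity
        have : 0 ≤ K₃ * (X + L) := by positivity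
        linarith
  rcases le_or_gt (δ ^ 3 * U) 1 with h3 | h3
  · have h1 := hsup E hE U k hU0 hkκ.le hkU.le S hS
    have h4 : U / k ≤ (δ⁻¹) ^ 2 := by
      refine le_of_sq_le_sq ?_ (by positivity)
      rw [div_pow, hk2, inv_pow, ← one_div, div_pow, one_pow,
        div_le_div_iff₀ (by positivity) (by positivity)]
      calc U ^ 2 * (δ ^ 2) ^ 2 = δ * U * (δ ^ 3 * U) := by ring
        _ ≤ δ * U * 1 := by gcongr
        _ = _ := by ring
    have h5 : (U / k) ^ (ε / 2) ≤ (δ⁻¹) ^ ε := by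
      calc (U / k) ^ (ε / 2) ≤ ((δ⁻¹) ^ 2) ^ (ε / 2) := by gcongr
        _ = (δ⁻¹) ^ ε := by
          rw [← Real.rpow_natCast, ← Real.rpow_mul (by positivity)]
          congr 1
          push_cast
          ring
    have h6 : k ^ 2 * U * (U / k) ^ (ε / 2) ≤ X := by
      calc k ^ 2 * U * (U / k) ^ (ε / 2) ≤ k ^ 2 * U * (δ⁻¹) ^ ε := by gcongr
        _ = X := by rw [hX, hδε, hk2]; ring
    calc (S.card : ℝ) ≤ K₂ * X := h1.trans (by gcongr)
      _ ≤ _ := by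
        have : 0 ≤ K₂ * L := by positivity
        have : 0 ≤ K₁ * (X + L) := by positivity
        have : 0 ≤ K₃ * (X + L) := by positivity
        linarith
  · have hk3 : U ≤ k ^ 3 := by
      refine le_of_sq_le_sq ?_ (by positivity)
      calc U ^ 2 = U ^ 2 * 1 := by ring
        _ ≤ U ^ 2 * (δ ^ 3 * U) := by gcongr
        _ = (k ^ 2) ^ 3 := by rw [hk2]; ring
        _ = _ := by ring
    have hk1 : 1 ≤ k := by
      by_contra! hlt
      have : k ^ 3 < 1 := pow_lt_one₀ hk0.le hlt (by norm_num)
      linarith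
    have h1 := hE.card_le_of_wide hC hR hk1 hkU hk3 hS
    rw [← hK₃] at h1
    have h6 : k ^ 2 * U ≤ X := by
      have : 1 ≤ (δ⁻¹) ^ ε := Real.one_le_rpow ((one_le_inv₀ hδ).2 hδ1.le) hε.le
      calc k ^ 2 * U = δ * 1 * U ^ 2 := by rw [hk2]; ring
        _ ≤ δ * (δ⁻¹) ^ ε * U ^ 2 := by gcongr
        _ = X := by rw [hX, hδε]
    calc (S.card : ℝ) ≤ K₃ * X := h1.trans (by gcongr)
      _ ≤ _ := by
        have : 0 ≤ K₃ * L := by positivity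
        have : 0 ≤ K₁ * (X + L) := by positivity
        have : 0 ≤ K₂ * (X + L) := by positivity
        linarith

section Curve

variable {α β : ℝ} {g g' g'' : ℝ → ℝ}

lemma monotoneOn_of_second_deriv_nonneg
    (hg' : ∀ x ∈ Icc α β, HasDerivWithinAt g' (g'' x) (Icc α β) x)
    (h0 : ∀ x ∈ Icc α β, 0 ≤ g'' x) : MonotoneOn g' (Icc α β) :=
  monotoneOn_of_hasDerivWithinAt_nonneg (convex_Icc α β)
    (fun x hx => (hg' x hx).continuousWithinAt)
    (fun x hx => (hg' x (interior_subset hx)).mono interior_subset)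
    (fun x hx => h0 x (interior_subset hx))

lemma tangent_le_of_second_deriv_nonneg
    (hg : ∀ x ∈ Icc α β, HasDerivWithinAt g (g' x) (Icc α β) x)
    (hg' : ∀ x ∈ Icc α β, HasDerivWithinAt g' (g'' x) (Icc α β) x)
    (h0 : ∀ x ∈ Icc α β, 0 ≤ g'' x) {x y : ℝ} (hx : x ∈ Icc α β) (hy : y ∈ Icc α β) :
    0 ≤ g y - g x - g' x * (y - x) := by
  have hmono := monotoneOn_of_second_deriv_nonneg hg' h0
  have slope : ∀ a ∈ Icc α β, ∀ b ∈ Icc α β, a < b →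
      ∃ z ∈ Icc α β, a ≤ z ∧ z ≤ b ∧ g b - g a = g' z * (b - a) := by
    intro a ha b hb hab
    have hsub : Icc a b ⊆ Icc α β := Icc_subset_Icc ha.1 hb.2
    obtain ⟨z, hz, hzs⟩ := exists_hasDerivAt_eq_slope g g' hab
      (fun w hw => ((hg w (hsub hw)).continuousWithinAt).mono hsub)
      (fun w hw => (hg w (hsub (Ioo_subset_Icc_self hw))).hasDerivAt
        (Icc_mem_nhds (ha.1.trans_lt hw.1) (hw.2.trans_le hb.2)))
    refine ⟨z, hsub (Ioo_subset_Icc_self hz), hz.1.le, hz.2.le, ?_⟩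
    rw [hzs, div_mul_cancel₀ _ (sub_pos.2 hab).ne']
  rcases lt_trichotomy x y with h | rfl | h
  · obtain ⟨z, hz, h1, h2, h3⟩ := slope x hx y hy h
    have := hmono hx hz h1
    rw [h3]
    nlinarith
  · simp
  · obtain ⟨z, hz, h1, h2, h3⟩ := slope y hy x hx h
    have := hmono hz hx h2
    nlinarith

/-- The tangents of a strictly convex curve form a convex arc. -/
lemma exists_isConvexArc_of_pos {c : ℝ} (hc : 0 < c)
    (hg : ∀ x ∈ Icc α β, HasDerivWithinAt g (g' x) (Icc α β) x)
    (hg' : ∀ x ∈ Icc α β, HasDerivWithinAt g' (g'' x) (Icc α β) x)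
    (hg'' : ContinuousOn g'' (Icc α β)) (hlow : ∀ x ∈ Icc α β, c ≤ g'' x) :
    ∃ C R : ℝ, 1 ≤ C ∧ 0 ≤ R ∧ IsConvexArc C R ((fun x => ⟨x, g x, g' x⟩) '' Icc α β) := by
  obtain ⟨B₀, hB₀⟩ := isCompact_Icc.exists_bound_of_continuousOn hg''
  obtain ⟨P, hP⟩ := isCompact_Icc.exists_bound_of_continuousOn
    (fun x hx => (hg' x hx).continuousWithinAt : ContinuousOn g' (Icc α β))
  obtain ⟨B, hB⟩ : ∃ B : ℝ, B = |B₀| := ⟨_, rfl⟩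
  have hB0 : 0 ≤ B := hB ▸ abs_nonneg _
  have hupp : ∀ x ∈ Icc α β, g'' x ≤ B := fun x hx =>
    (le_abs_self _).trans ((hB₀ x hx).trans (hB ▸ le_abs_self _))
  have low : ∀ x ∈ Icc α β, ∀ y ∈ Icc α β, c / 2 * (y - x) ^ 2 ≤ g y - g x - g' x * (y - x) := by
    intro x hx y hy
    have := tangent_le_of_second_deriv_nonneg (g := fun x => g x - c / 2 * x ^ 2)
      (g' := fun x => g' x - c * x) (g'' := fun x => g'' x - c)
      (fun x hx => ((hg x hx).sub (((hasDerivWithinAt_id x _).pow 2).const_mul (c / 2))).congr_deriv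
        (by simp; ring))
      (fun x hx => ((hg' x hx).sub ((hasDerivWithinAt_id x _).const_mul c)).congr_deriv
        (by simp))
      (fun x hx => sub_nonneg.2 (hlow x hx)) hx hy
    linarith
  have upp : ∀ x ∈ Icc α β, ∀ y ∈ Icc α β, g y - g x - g' x * (y - x) ≤ B / 2 * (y - x) ^ 2 := by
    intro x hx y hy
    have := tangent_le_of_second_deriv_nonneg (g := fun x => B / 2 * x ^ 2 - g x)
      (g' := fun x => B * x - g' x) (g'' := fun x => B - g'' x)
      (fun x hx => ((((hasDerivWithinAt_id x _).pow 2).const_mul (B / 2)).sub (hg x hx)).congr_deriv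
        (by simp; ring))
      (fun x hx => (((hasDerivWithinAt_id x _).const_mul B).sub (hg' x hx)).congr_deriv
        (by simp))
      (fun x hx => sub_nonneg.2 (hupp x hx)) hx hy
    linarith
  have slow : ∀ x ∈ Icc α β, ∀ y ∈ Icc α β, c ^ 2 * (y - x) ^ 2 ≤ (g' y - g' x) ^ 2 := by
    intro x hx y hy
    have h1 := low x hx y hy
    have h2 := low y hy x hx
    have h3 : c * (y - x) ^ 2 ≤ (g' y - g' x) * (y - x) := by linarith
    rcases eq_or_ne y x with rfl | hne
    · simp
    have h4 : 0 < (y - x) ^ 2 := sq_pos_of_ne_zero (sub_ne_zero.2 hne)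
    refine le_of_mul_le_mul_right ?_ h4
    calc c ^ 2 * (y - x) ^ 2 * (y - x) ^ 2 = (c * (y - x) ^ 2) ^ 2 := by ring
      _ ≤ ((g' y - g' x) * (y - x)) ^ 2 := by gcongr
      _ = _ := by ring
  have supp : ∀ x ∈ Icc α β, ∀ y ∈ Icc α β, (g' y - g' x) ^ 2 ≤ B ^ 2 * (y - x) ^ 2 := by
    intro x hx y hy
    have h1 := (convex_Icc α β).norm_image_sub_le_of_norm_hasDerivWithin_le hg'
      (fun x hx => (hB₀ x hx).trans (hB ▸ le_abs_self _)) hx hy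
    rw [Real.norm_eq_abs, Real.norm_eq_abs] at h1
    rw [← mul_pow, ← sq_abs, ← sq_abs (B * _), abs_mul, abs_of_nonneg hB0]
    gcongr
  have scale : ∀ {C a b d : ℝ}, a ≤ d * b → d ≤ C → 0 ≤ b → a ≤ C * b := fun h1 h2 h3 =>
    h1.trans (by gcongr)
  have n1 : 0 ≤ 2 / c := by positivity
  have n2 : 0 ≤ 2 / c * B ^ 2 := by positivity
  have n3 : 0 ≤ B / 2 / c ^ 2 := by positivity
  refine ⟨1 + 2 / c + B / 2 + 2 / c * B ^ 2 + B / 2 / c ^ 2, |α| + |β| + |P|, by linarith,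
    by positivity, ?_, ?_, ?_, ?_, ?_, ?_⟩
  · rintro _ ⟨x, hx, rfl⟩
    have h1 := abs_le_max_abs_abs hx.1 hx.2
    have h2 : max |α| |β| ≤ |α| + |β| :=
      max_le (by linarith [abs_nonneg β]) (by linarith [abs_nonneg α])
    simp only
    linarith [abs_nonneg P]
  · rintro _ ⟨x, hx, rfl⟩
    have h1 := hP x hx
    rw [Real.norm_eq_abs] at h1
    simp only
    linarith [abs_nonneg α, abs_nonneg β, le_abs_self P]
  all_goals
    rintro _ ⟨x, hx, rfl⟩ _ ⟨y, hy, rfl⟩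
    simp only [gap]
    have h1 := low x hx y hy
    have h2 := upp x hx y hy
    have h3 := slow x hx y hy
    have h4 := supp x hx y hy
    have h0 : 0 ≤ g y - g x - g' x * (y - x) := le_trans (by positivity) h1
    have h5 : (y - x) ^ 2 ≤ 2 / c * (g y - g x - g' x * (y - x)) := by
      rw [div_mul_eq_mul_div, le_div_iff₀ hc]
      linarith
  · exact scale h5 (by linarith) h0
  · exact scale h2 (by linarith) (sq_nonneg _)
  · refine scale (d := 2 / c * B ^ 2) ?_ (by linarith) h0
    calc (g' y - g' x) ^ 2 ≤ B ^ 2 * (y - x) ^ 2 := h4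
      _ ≤ B ^ 2 * (2 / c * (g y - g x - g' x * (y - x))) := by gcongr
      _ = _ := by ring
  · refine scale (d := B / 2 / c ^ 2) ?_ (by linarith) (sq_nonneg _)
    calc g y - g x - g' x * (y - x) ≤ B / 2 * (y - x) ^ 2 := h2
      _ = B / 2 / c ^ 2 * (c ^ 2 * (y - x) ^ 2) := by field_simp
      _ ≤ _ := by gcongr

lemma exists_sign_isConvexArc {c : ℝ} (hc : 0 < c)
    (hg : ∀ x ∈ Icc α β, HasDerivWithinAt g (g' x) (Icc α β) x)
    (hg' : ∀ x ∈ Icc α β, HasDerivWithinAt g' (g'' x) (Icc α β) x)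
    (hg'' : ContinuousOn g'' (Icc α β)) (hlow : ∀ x ∈ Icc α β, c ≤ |g'' x|) :
    ∃ s : ℤ, |s| = 1 ∧ ∃ C R : ℝ, 1 ≤ C ∧ 0 ≤ R ∧
      IsConvexArc C R ((fun x => ⟨x, s * g x, s * g' x⟩) '' Icc α β) := by
  obtain ⟨s, hs, hsg⟩ : ∃ s : ℤ, |s| = 1 ∧ ∀ x ∈ Icc α β, c ≤ s * g'' x := by
    by_cases h : ∀ x ∈ Icc α β, 0 < g'' x
    · refine ⟨1, by simp, fun x hx => ?_⟩
      simpa [abs_of_pos (h x hx)] using hlow x hx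
    · push Not at h
      obtain ⟨y, hy, hy0⟩ := h
      refine ⟨-1, by simp, fun x hx => ?_⟩
      have hx0 : g'' x ≤ 0 := by
        by_contra! hx0
        obtain ⟨z, hz, hz0⟩ := isPreconnected_Icc.intermediate_value hy hx hg'' ⟨hy0, hx0.le⟩
        have := hlow z hz
        rw [hz0, abs_zero] at this
        linarith
      simpa [abs_of_nonpos hx0] using hlow x hx
  exact ⟨s, hs, exists_isConvexArc_of_pos hc (fun x hx => (hg x hx).const_mul (s : ℝ))
    (fun x hx => (hg' x hx).const_mul (s : ℝ)) (hg''.const_smul (s : ℝ)) hsg⟩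

end Curve

theorem count_rationals_near_planar_curve
    (α β : ℝ) (hαβ : α ≤ β) (c : ℝ) (hc : 0 < c)
    (φ φ' φ'' : ℝ → ℝ)
    (hφ : ∀ x ∈ Icc α β, HasDerivWithinAt φ (φ' x) (Icc α β) x)
    (hφ' : ∀ x ∈ Icc α β, HasDerivWithinAt φ' (φ'' x) (Icc α β) x)
    (hφ'' : ContinuousOn φ'' (Icc α β))
    (hlow : ∀ x ∈ Icc α β, c ≤ |φ'' x|) :
    ∀ ε : ℝ, 0 < ε → ∃ C : ℝ, 0 < C ∧
      ∀ δ U : ℝ, 0 < δ → δ < 1/4 → 1 ≤ U →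
        ({p : ℤ × ℤ | U ≤ (p.1 : ℝ) ∧ (p.1 : ℝ) < 2 * U ∧
            (p.2 : ℝ) / (p.1 : ℝ) ∈ Icc α β ∧
            nint ((p.1 : ℝ) * φ ((p.2 : ℝ) / (p.1 : ℝ))) < δ}.ncard : ℝ)
          ≤ C * (δ ^ ((1 : ℝ) - ε) * U ^ 2 + U * Real.log (2 * U)) := by
  intro ε hε
  obtain ⟨s, hs, C, R, hC, hR, hE⟩ := exists_sign_isConvexArc hc hφ hφ' hφ'' hlow
  obtain ⟨K, hK, hbound⟩ := exists_near_bound hC hR hε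
  refine ⟨K, hK, fun δ U hδ hδ4 hU => ?_⟩
  set P := {p : ℤ × ℤ | U ≤ (p.1 : ℝ) ∧ (p.1 : ℝ) < 2 * U ∧ (p.2 : ℝ) / (p.1 : ℝ) ∈ Icc α β ∧
    nint ((p.1 : ℝ) * φ ((p.2 : ℝ) / (p.1 : ℝ))) < δ} with hP
  have hU0 : 0 < U := by linarith
  have hlog : 0 ≤ Real.log (2 * U) := Real.log_nonneg (by linarith)
  rcases P.finite_or_infinite with hfin | hinf
  swap
  · rw [hinf.ncard, Nat.cast_zero]
    positivity
  set F : ℤ × ℤ → ℤ × ℤ × ℤ := fun p =>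
    (p.1, p.2, s * round ((p.1 : ℝ) * φ ((p.2 : ℝ) / (p.1 : ℝ)))) with hF
  have hinj : Function.Injective F := by
    intro p q hpq
    simp only [hF, Prod.mk.injEq] at hpq
    exact Prod.ext hpq.1 hpq.2.1
  rw [Set.ncard_eq_toFinset_card P hfin, ← Finset.card_image_of_injective _ hinj]
  refine hbound _ hE δ U hδ (by linarith) hU _ fun v hv => ?_
  obtain ⟨p, hp, rfl⟩ := Finset.mem_image.1 hv
  obtain ⟨h1, h2, h3, h4⟩ := hfin.mem_toFinset.1 hp
  have hp0 : (0 : ℝ) < p.1 := hU0.trans_le h1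
  refine ⟨h1, h2, _, ⟨_, h3, rfl⟩, ?_, ?_⟩
  · simp only [hoff, hF, mul_div_cancel₀ _ hp0.ne', sub_self, abs_zero]
    exact Real.sqrt_nonneg _
  · rw [Real.sq_sqrt (by positivity), mul_div_cancel_right₀ _ hU0.ne']
    have hs' : |(s : ℝ)| = 1 := by exact_mod_cast hs
    simp only [voff, hF, mul_div_cancel₀ _ hp0.ne', sub_self, mul_zero, sub_zero, Int.cast_mul]
    rw [mul_left_comm, ← mul_sub, abs_mul, hs', one_mul, abs_sub_comm]
    exact h4.le
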